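/- (Sturm Separation Theorem II) Assume r ∈ [0,1] is fixed, α is strictly increasing on (a,b), β ∈ BV_loc((a,b),ℝ), and θ_{1−r}(x) ≠ 0 and θ_r(x) ≠ 0 for all x ∈ (a,b). Let u and v be linearly independent real-valued r-balanced solutions of −d(dy/dα) + y dβ = 0 on (a,b), and let s < t be consecutive points of Z_{(a,b)}(u) with θ > 0 on (s,t). Then: (1) if u^-(s) u^+(s) < 0, u^-(t) = 0, and θ_r(s) > 0, then v changes sign in [s,t); (2) if u^+(s) = 0, u^-(t) u^+(t) < 0, and θ_{1−r}(t) > 0, then v changes sign in (s,t]; (3) if u^-(s) u^+(s) < 0, u^+(t) = 0, and θ_r(s) θ_{1−r}(t) > 0, then v changes sign in [s,t]; (4) if u^-(s) = 0, u^-(t) u^+(t) < 0, and θ_r(s) θ_{1−r}(t) > 0, then v changes sign in [s,t]; (5) if u^-(s) u^+(s) < 0, u^-(t) u^+(t) < 0, and θ_r(s) θ_{1−r}(t) > 0, then v changes sign in [s,t]. -/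

import Mathlib

open Set Filter Function MeasureTheory Topology

noncomputable section

/-- The open interval `(a,b) ⊆ ℝ` determined by extended-real endpoints `a`, `b`. -/
def EI (a b : EReal) : Set ℝ := {x : ℝ | a < (x : EReal) ∧ (x : EReal) < b}

/-- The jump `Δ_{df}(x) = f⁺(x) - f⁻(x)` of a real-valued function. -/
def jump (f : ℝ → ℝ) (x : ℝ) : ℝ := rightLim f x - leftLim f x

/-- The jump `Δ_{df}(x) = f⁺(x) - f⁻(x)` of a complex-valued function. -/
def jumpC (f : ℝ → ℂ) (x : ℝ) : ℂ := rightLim f x - leftLim f x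

/-- `θ_z(x) = 1 - z² Δ_{dα}(x) Δ_{dβ}(x)`. -/
def theta (α β : ℝ → ℝ) (z x : ℝ) : ℝ := 1 - z ^ 2 * jump α x * jump β x

/-- `ω(x) = 1 - Δ_{dα}(x) Δ_{dβ}(x) / 4`. -/
def omegaFn (α β : ℝ → ℝ) (x : ℝ) : ℝ := 1 - jump α x * jump β x / 4

/-- A real-valued function is `r`-balanced on `I`: it is of locally bounded variation and
`f(x) = r f⁻(x) + (1-r) f⁺(x)` for all `x ∈ I`. -/
def RBalanced (r : ℝ) (I : Set ℝ) (f : ℝ → ℝ) : Prop :=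
  LocallyBoundedVariationOn f I ∧
    ∀ x ∈ I, f x = r * leftLim f x + (1 - r) * rightLim f x

/-- A complex-valued function is `r`-balanced on `I`. -/
def RBalancedC (r : ℂ) (I : Set ℝ) (f : ℝ → ℂ) : Prop :=
  LocallyBoundedVariationOn f I ∧
    ∀ x ∈ I, f x = r * leftLim f x + (1 - r) * rightLim f x

/-- `ν` coincides on `[c,d]` with the Lebesgue–Stieltjes measure `df` generated by `f`,
determined by `df((x,y]) = f⁺(y) - f⁺(x)`. -/
def SMRepresents (ν : SignedMeasure ℝ) (f : ℝ → ℝ) (c d : ℝ) : Prop :=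
  ∀ x ∈ Icc c d, ∀ y ∈ Icc c d, x ≤ y → ν (Ioc x y) = rightLim f y - rightLim f x

/-- The integral of `h` against the signed measure `ν` over the set `E`. -/
def sInt (ν : SignedMeasure ℝ) (h : ℝ → ℝ) (E : Set ℝ) : ℝ :=
  (∫ x in E, h x ∂ν.toJordanDecomposition.posPart) -
    (∫ x in E, h x ∂ν.toJordanDecomposition.negPart)

/-- The equality of (locally finite, real Borel) measures `dg = ∑ j, (h j) d(β j)` on the
interval `I`, expressed via localizations to compact subintervals of `I`. -/
def MeasureEqOn (I : Set ℝ) {ι : Type} [Fintype ι] (g : ℝ → ℝ) (h β : ι → ℝ → ℝ) : Prop :=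
  ∀ c ∈ I, ∀ d ∈ I, c < d →
    ∃ (νg : SignedMeasure ℝ) (ν : ι → SignedMeasure ℝ),
      SMRepresents νg g c d ∧ (∀ j, SMRepresents (ν j) (β j) c d) ∧
      ∀ E : Set ℝ, E ⊆ Ioc c d → MeasurableSet E → νg E = ∑ j, sInt (ν j) (h j) E

/-- The equality of complex measures `dg = ∑ j, (h j) d(β j)` on `I`, encoded via real and
imaginary parts. -/
def MeasureEqOnC (I : Set ℝ) {ι : Type} [Fintype ι] (g : ℝ → ℂ) (h β : ι → ℝ → ℂ) : Prop :=
  MeasureEqOn I (fun x => (g x).re)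
    (Sum.elim (fun j x => (h j x).re) (fun j x => -(h j x).im))
    (Sum.elim (fun j x => (β j x).re) (fun j x => (β j x).im)) ∧
  MeasureEqOn I (fun x => (g x).im)
    (Sum.elim (fun j x => (h j x).im) (fun j x => (h j x).re))
    (Sum.elim (fun j x => (β j x).re) (fun j x => (β j x).im))

/-- The support of `dα` is all of `I`: no open subinterval of `I` is `dα`-null, i.e. on no
open subinterval of `I` do all one-sided limits of `α` coincide with a single constant. -/
def SuppFull (I : Set ℝ) (α : ℝ → ℂ) : Prop :=
  ∀ x ∈ I, ∀ ε > (0 : ℝ), Icc (x - ε) (x + ε) ⊆ I →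
    ¬ (∀ p ∈ Ioo (x - ε) (x + ε), ∀ q ∈ Ioo (x - ε) (x + ε),
        rightLim α p = rightLim α q ∧ leftLim α p = rightLim α q)

/-- `u`, together with the representative `w` of `du/dα`, is an `r`-balanced solution of the
homogeneous equation `-d(du/dα) + u dβ = 0` on `I`: `u` and `w` are `r`-balanced,
`du = w dα` (so `du ≪ dα` with `du/dα = w`), and `dw = u dβ`. -/
def IsHomSol (I : Set ℝ) (r : ℝ) (α β u w : ℝ → ℝ) : Prop :=
  RBalanced r I u ∧ RBalanced r I w ∧
  MeasureEqOn I u (fun _ : Fin 1 => w) (fun _ => α) ∧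
  MeasureEqOn I w (fun _ : Fin 1 => u) (fun _ => β)

/-- `u`, together with the representative `w` of `du/dα`, is an `r`-balanced solution of
`-d(du/dα) + u dβ = dη` on `I` (complex-valued coefficients): `dw = u dβ - dη`. -/
def IsSolC (I : Set ℝ) (r : ℂ) (α β η u w : ℝ → ℂ) : Prop :=
  RBalancedC r I u ∧ RBalancedC r I w ∧
  MeasureEqOnC I u (fun _ : Fin 1 => w) (fun _ => α) ∧
  MeasureEqOnC I w ![u, fun _ => (-1 : ℂ)] ![β, η]

/-- `y` solves the linear system `dy = dφ · y + dψ` on `I`, componentwise: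
`d(y i) = ∑ j, (y j) d(φ i j) + dψ i`. -/
def IsSysSolC (I : Set ℝ) (n : ℕ) (φ : ℝ → Matrix (Fin n) (Fin n) ℂ)
    (ψ : ℝ → Fin n → ℂ) (y : ℝ → Fin n → ℂ) : Prop :=
  ∀ i : Fin n,
    MeasureEqOnC I (fun x => y x i)
      (Sum.elim (fun j : Fin n => fun x => y x j) (fun _ : Unit => fun _ => (1 : ℂ)))
      (Sum.elim (fun j : Fin n => fun x => φ x i j) (fun _ : Unit => fun x => ψ x i))

/-- `Z_I(f) = {x ∈ I : f⁻(x) f⁺(x) ≤ 0}`, the set of sign-changing points of `f` in `I`. -/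
def ZSet (f : ℝ → ℝ) (I : Set ℝ) : Set ℝ := {x ∈ I | leftLim f x * rightLim f x ≤ 0}

/-- `u` changes sign at `s ∈ I`. -/
def ChangesSignAt (I : Set ℝ) (u : ℝ → ℝ) (s : ℝ) : Prop :=
  ∃ δ > (0 : ℝ), Ioo (s - δ) (s + δ) ⊆ I ∧
    (((∀ x ∈ Ioo (s - δ) s, leftLim u x < 0) ∧ ∀ x ∈ Ioo s (s + δ), 0 < rightLim u x) ∨
     ((∀ x ∈ Ioo (s - δ) s, 0 < leftLim u x) ∧ ∀ x ∈ Ioo s (s + δ), rightLim u x < 0))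

/-- `u` changes sign in `J` (a subinterval of `I`). -/
def ChangesSignIn (I : Set ℝ) (u : ℝ → ℝ) (J : Set ℝ) : Prop :=
  ∃ s ∈ J, ChangesSignAt I u s

/-- `u` and `v` are linearly dependent on `I`. -/
def LinDepOn (I : Set ℝ) (u v : ℝ → ℝ) : Prop :=
  ∃ c₁ c₂ : ℝ, ¬(c₁ = 0 ∧ c₂ = 0) ∧ ∀ x ∈ I, c₁ * u x + c₂ * v x = 0

/-- The Lebesgue–Stieltjes measure `dg` is nonnegative on (Borel subsets of) `S`, expressed by
nonnegativity on all subintervals of `S` of each of the four kinds. -/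
def PosMeasureOn (g : ℝ → ℝ) (S : Set ℝ) : Prop :=
  (∀ x y : ℝ, x ≤ y → Icc x y ⊆ S → 0 ≤ rightLim g y - leftLim g x) ∧
  (∀ x y : ℝ, x ≤ y → Ico x y ⊆ S → 0 ≤ leftLim g y - leftLim g x) ∧
  (∀ x y : ℝ, x ≤ y → Ioc x y ⊆ S → 0 ≤ rightLim g y - rightLim g x) ∧
  (∀ x y : ℝ, x < y → Ioo x y ⊆ S → 0 ≤ leftLim g y - rightLim g x)

/-- `f` has finite one-sided limits at every point of `I`. -/
def HasOneSidedLims (f : ℝ → ℝ) (I : Set ℝ) : Prop :=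
  ∀ x ∈ I, Tendsto f (𝓝[<] x) (𝓝 (leftLim f x)) ∧ Tendsto f (𝓝[>] x) (𝓝 (rightLim f x))

theorem HasOneSidedLims.of_locallyBoundedVariationOn {f : ℝ → ℝ} {I : Set ℝ} (hI : IsOpen I)
    (hf : LocallyBoundedVariationOn f I) : HasOneSidedLims f I := by
  intro x hx
  obtain ⟨c, d, hcd, hsub⟩ := mem_nhds_iff_exists_Ioo_subset.1 (hI.mem_nhds hx)
  obtain ⟨c', hc1, hc2⟩ := exists_between hcd.1
  obtain ⟨d', hd1, hd2⟩ := exists_between hcd.2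
  have hc' : c' ∈ I := hsub ⟨hc1, hc2.trans (hd1.trans hd2)⟩
  have hd' : d' ∈ I := hsub ⟨hc1.trans (hc2.trans hd1), hd2⟩
  have hb : BoundedVariationOn f (I ∩ Icc c' d') := hf c' d' hc' hd'
  have hn : I ∩ Icc c' d' ∈ 𝓝 x := inter_mem (hI.mem_nhds hx) (Icc_mem_nhds hc2 hd1)
  constructor
  · apply tendsto_leftLim_of_tendsto
    obtain ⟨l, hl⟩ := hb.exists_tendsto_left x
    refine ⟨l, ?_⟩
    rwa [nhdsWithin_inter_of_mem (mem_nhdsWithin_of_mem_nhds hn)] at hl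
  · apply tendsto_rightLim_of_tendsto
    obtain ⟨l, hl⟩ := hb.exists_tendsto_right x
    refine ⟨l, ?_⟩
    rwa [nhdsWithin_inter_of_mem (mem_nhdsWithin_of_mem_nhds hn)] at hl

theorem leftLim_mem_of_eventually {f : ℝ → ℝ} {V : Set ℝ} {y : ℝ} (hV : IsClosed V)
    (h : ∀ᶠ z in 𝓝 y, f z ∈ V) : leftLim f y ∈ V :=
  hV.mem_of_mapClusterPt (mapClusterPt_leftLim f y) (h.filter_mono nhdsWithin_le_nhds)

theorem rightLim_mem_of_eventually {f : ℝ → ℝ} {V : Set ℝ} {y : ℝ} (hV : IsClosed V)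
    (h : ∀ᶠ z in 𝓝 y, f z ∈ V) : rightLim f y ∈ V :=
  hV.mem_of_mapClusterPt (mapClusterPt_rightLim f y) (h.filter_mono nhdsWithin_le_nhds)

theorem tendsto_lims_of_isOpen {f : ℝ → ℝ} {U : Set ℝ} (hU : IsOpen U) {x L : ℝ}
    (h : Tendsto f (𝓝[U] x) (𝓝 L)) :
    Tendsto (leftLim f) (𝓝[U] x) (𝓝 L) ∧ Tendsto (rightLim f) (𝓝[U] x) (𝓝 L) := by
  constructor <;>
  · apply (closed_nhds_basis L).tendsto_right_iff.2
    rintro V ⟨hVn, hVc⟩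
    have h1 : ∀ᶠ z in 𝓝[U] x, f z ∈ V := h hVn
    have h2 := eventually_eventually_nhdsWithin.2 h1
    filter_upwards [h2, self_mem_nhdsWithin] with y hy hyU
    rw [hU.nhdsWithin_eq hyU] at hy
    first
      | exact leftLim_mem_of_eventually hVc hy
      | exact rightLim_mem_of_eventually hVc hy

namespace HasOneSidedLims

variable {f g : ℝ → ℝ} {I : Set ℝ} {x : ℝ}

theorem leftLim_left (hf : HasOneSidedLims f I) (hx : x ∈ I) :
    Tendsto (leftLim f) (𝓝[<] x) (𝓝 (leftLim f x)) :=
  (tendsto_lims_of_isOpen isOpen_Iio (hf x hx).1).1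

theorem rightLim_left (hf : HasOneSidedLims f I) (hx : x ∈ I) :
    Tendsto (rightLim f) (𝓝[<] x) (𝓝 (leftLim f x)) :=
  (tendsto_lims_of_isOpen isOpen_Iio (hf x hx).1).2

theorem leftLim_right (hf : HasOneSidedLims f I) (hx : x ∈ I) :
    Tendsto (leftLim f) (𝓝[>] x) (𝓝 (rightLim f x)) :=
  (tendsto_lims_of_isOpen isOpen_Ioi (hf x hx).2).1

theorem rightLim_right (hf : HasOneSidedLims f I) (hx : x ∈ I) :
    Tendsto (rightLim f) (𝓝[>] x) (𝓝 (rightLim f x)) :=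
  (tendsto_lims_of_isOpen isOpen_Ioi (hf x hx).2).2

theorem lims_linearCombination (hf : HasOneSidedLims f I) (hg : HasOneSidedLims g I) (c₁ c₂ : ℝ)
    (hx : x ∈ I) :
    leftLim (fun y => c₁ * f y + c₂ * g y) x = c₁ * leftLim f x + c₂ * leftLim g x ∧
    rightLim (fun y => c₁ * f y + c₂ * g y) x = c₁ * rightLim f x + c₂ * rightLim g x :=
  ⟨leftLim_eq_of_tendsto (((hf x hx).1.const_mul c₁).add ((hg x hx).1.const_mul c₂)),
    rightLim_eq_of_tendsto (((hf x hx).2.const_mul c₁).add ((hg x hx).2.const_mul c₂))⟩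

theorem lims_sub (hf : HasOneSidedLims f I) (hg : HasOneSidedLims g I) (hx : x ∈ I) :
    leftLim (fun y => f y - g y) x = leftLim f x - leftLim g x ∧
    rightLim (fun y => f y - g y) x = rightLim f x - rightLim g x :=
  ⟨leftLim_eq_of_tendsto ((hf x hx).1.sub (hg x hx).1),
    rightLim_eq_of_tendsto ((hf x hx).2.sub (hg x hx).2)⟩

theorem lims_mul (hf : HasOneSidedLims f I) (hg : HasOneSidedLims g I) (hx : x ∈ I) :
    leftLim (fun y => f y * g y) x = leftLim f x * leftLim g x ∧
    rightLim (fun y => f y * g y) x = rightLim f x * rightLim g x :=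
  ⟨leftLim_eq_of_tendsto ((hf x hx).1.mul (hg x hx).1),
    rightLim_eq_of_tendsto ((hf x hx).2.mul (hg x hx).2)⟩

theorem mul (hf : HasOneSidedLims f I) (hg : HasOneSidedLims g I) :
    HasOneSidedLims (fun y => f y * g y) I := by
  intro x hx
  rw [(hf.lims_mul hg hx).1, (hf.lims_mul hg hx).2]
  exact ⟨(hf x hx).1.mul (hg x hx).1, (hf x hx).2.mul (hg x hx).2⟩

theorem sub (hf : HasOneSidedLims f I) (hg : HasOneSidedLims g I) :
    HasOneSidedLims (fun y => f y - g y) I := by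
  intro x hx
  rw [(hf.lims_sub hg hx).1, (hf.lims_sub hg hx).2]
  exact ⟨(hf x hx).1.sub (hg x hx).1, (hf x hx).2.sub (hg x hx).2⟩

theorem mono {J : Set ℝ} (hf : HasOneSidedLims f I) (h : J ⊆ I) : HasOneSidedLims f J :=
  fun x hx => hf x (h hx)

/-- If the one-sided limits of `f` have the same strict sign at each point of a preconnected set,
then they have a constant sign on that set. -/
theorem constant_sign (hf : HasOneSidedLims f I) (hI : IsPreconnected I)
    (h : ∀ x ∈ I, 0 < leftLim f x * rightLim f x) :
    (∀ x ∈ I, 0 < leftLim f x ∧ 0 < rightLim f x) ∨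
      (∀ x ∈ I, leftLim f x < 0 ∧ rightLim f x < 0) := by
  have key : ∀ x ∈ I, ∀ y ∈ I, (0 < rightLim f x ↔ 0 < rightLim f y) := by
    intro x hx y hy
    refine hI.induction₂ (fun x y => (0 < rightLim f x ↔ 0 < rightLim f y)) ?_
      (fun _ _ _ _ _ _ h1 h2 => h1.trans h2) (fun _ _ _ _ h1 => h1.symm) hx hy
    intro x hx
    refine Filter.Eventually.filter_mono nhdsWithin_le_nhds ?_
    rw [← nhdsNE_sup_pure x, ← nhdsLT_sup_nhdsGT]
    refine eventually_sup.2 ⟨eventually_sup.2 ?_, by simp⟩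
    rcases pos_and_pos_or_neg_and_neg_of_mul_pos (h x hx) with ⟨h1, h2⟩ | ⟨h1, h2⟩
    · constructor
      · filter_upwards [(hf.rightLim_left hx).eventually_const_lt h1] with y hy
        exact ⟨fun _ => hy, fun _ => h2⟩
      · filter_upwards [(hf.rightLim_right hx).eventually_const_lt h2] with y hy
        exact ⟨fun _ => hy, fun _ => h2⟩
    · constructor
      · filter_upwards [(hf.rightLim_left hx).eventually_lt_const h1] with y hy
        exact ⟨fun h3 => (h2.not_gt h3).elim, fun h3 => (hy.not_gt h3).elim⟩
      · filter_upwards [(hf.rightLim_right hx).eventually_lt_const h2] with y hy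
        exact ⟨fun h3 => (h2.not_gt h3).elim, fun h3 => (hy.not_gt h3).elim⟩
  by_cases hex : ∃ x ∈ I, 0 < rightLim f x
  · left
    obtain ⟨x, hx, hp⟩ := hex
    intro y hy
    have h1 := (key x hx y hy).1 hp
    exact ⟨pos_of_mul_pos_left (h y hy) h1.le, h1⟩
  · right
    push Not at hex
    intro y hy
    rcases pos_and_pos_or_neg_and_neg_of_mul_pos (h y hy) with h1 | h1
    · exact absurd h1.2 (hex y hy).not_gt
    · exact h1

end HasOneSidedLims

theorem measureReal_Ioc_tendsto_zero (μ : Measure ℝ) [IsFiniteMeasure μ] (x : ℝ) :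
    Tendsto (fun y => μ.real (Ioc x y)) (𝓝[>] x) (𝓝 0) := by
  have h := tendsto_measure_biInter_gt (μ := μ) (s := fun y => Ioc x y) (a := x)
    (fun r _ => measurableSet_Ioc.nullMeasurableSet) (fun i j _ hij => Ioc_subset_Ioc_right hij)
    ⟨x + 1, by simp, measure_ne_top _ _⟩
  have he : (⋂ r > x, Ioc x r) = ∅ := by
    ext z
    simp only [mem_iInter, mem_Ioc, mem_empty_iff_false, iff_false, not_forall]
    by_contra! hc
    have h1 := (hc (x + 1) (by simp)).1
    obtain ⟨m, hm1, hm2⟩ := exists_between h1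
    exact absurd (hc m hm1).2 hm2.not_ge
  rw [he, measure_empty] at h
  have h2 := (ENNReal.tendsto_toReal ENNReal.zero_ne_top).comp h
  rw [ENNReal.toReal_zero] at h2
  exact h2

theorem measureReal_Ioo_tendsto_zero (μ : Measure ℝ) [IsFiniteMeasure μ] (x : ℝ) :
    Tendsto (fun y => μ.real (Ioo y x)) (𝓝[<] x) (𝓝 0) := by
  have h := tendsto_measure_biInter_gt (ι := ℝᵒᵈ) (μ := μ)
    (s := fun y => Ioo (OrderDual.ofDual y) x) (a := OrderDual.toDual x)
    (fun r _ => measurableSet_Ioo.nullMeasurableSet)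
    (fun i j _ hij => Ioo_subset_Ioo_left hij)
    ⟨OrderDual.toDual (x - 1), OrderDual.toDual_lt_toDual.2 (sub_one_lt x), measure_ne_top _ _⟩
  have he : (⋂ r > OrderDual.toDual x, Ioo (OrderDual.ofDual r) x) = ∅ := by
    ext z
    simp only [mem_iInter, mem_Ioo, mem_empty_iff_false, iff_false, not_forall]
    by_contra! hc
    have h1 := (hc (OrderDual.toDual (x - 1)) (OrderDual.toDual_lt_toDual.2 (sub_one_lt x))).2
    obtain ⟨m, hm1, hm2⟩ := exists_between h1
    exact absurd (hc (OrderDual.toDual m) hm2).1 hm1.not_gt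
  rw [he, measure_empty] at h
  have h2 := (ENNReal.tendsto_toReal ENNReal.zero_ne_top).comp h
  rw [ENNReal.toReal_zero] at h2
  exact h2

/-- Two differences of finite measures which agree on half-open intervals give the same
integrals. -/
theorem integral_sub_integral_eq_of_Ioc {P N P' N' : Measure ℝ} [IsFiniteMeasure P]
    [IsFiniteMeasure N] [IsFiniteMeasure P'] [IsFiniteMeasure N'] {c d : ℝ}
    (h : ∀ x ∈ Icc c d, ∀ y ∈ Icc c d, x ≤ y →
      P.real (Ioc x y) - N.real (Ioc x y) = P'.real (Ioc x y) - N'.real (Ioc x y))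
    {E : Set ℝ} (hE : E ⊆ Ioc c d) {g : ℝ → ℝ}
    (hP : IntegrableOn g E P) (hN : IntegrableOn g E N)
    (hP' : IntegrableOn g E P') (hN' : IntegrableOn g E N') (hEm : MeasurableSet E) :
    (∫ x in E, g x ∂P) - (∫ x in E, g x ∂N) = (∫ x in E, g x ∂P') - ∫ x in E, g x ∂N' := by
  have hm : (P + N').restrict (Ioc c d) = (P' + N).restrict (Ioc c d) := by
    refine Measure.ext_of_Ioc _ _ fun x y _ => ?_
    rw [Measure.restrict_apply measurableSet_Ioc, Measure.restrict_apply measurableSet_Ioc,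
      Ioc_inter_Ioc]
    rcases le_or_gt (x ⊔ c) (y ⊓ d) with hle | hlt
    · have h1 := h (x ⊔ c) ⟨le_sup_right, hle.trans inf_le_right⟩ (y ⊓ d)
        ⟨le_sup_right.trans hle, inf_le_right⟩ hle
      rw [← measureReal_eq_measureReal_iff, measureReal_add_apply, measureReal_add_apply]
      linarith
    · simp [Ioc_eq_empty_of_le hlt.le]
  have hr : (P + N').restrict E = (P' + N).restrict E := by
    rw [← inter_eq_self_of_subset_left hE, ← Measure.restrict_restrict hEm, hm,
      Measure.restrict_restrict hEm]
  rw [Measure.restrict_add, Measure.restrict_add] at hr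
  have h1 := integral_add_measure (f := g) hP hN'
  have h2 := integral_add_measure (f := g) hP' hN
  rw [hr] at h1
  linarith

/-- `f` is integrable over compact subintervals of `I` with respect to all finite measures. -/
def UniversallyLocIntegrable (f : ℝ → ℝ) (I : Set ℝ) : Prop :=
  ∀ c ∈ I, ∀ d ∈ I, ∀ (μ : Measure ℝ) [IsFiniteMeasure μ], IntegrableOn f (Icc c d) μ

theorem UniversallyLocIntegrable.of_locallyBoundedVariationOn {f : ℝ → ℝ} {I : Set ℝ}
    [hI : OrdConnected I] (hf : LocallyBoundedVariationOn f I) : UniversallyLocIntegrable f I := by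
  intro c hc d hd μ _
  obtain ⟨p, q, hp, hq, rfl⟩ := hf.exists_monotoneOn_sub_monotoneOn
  exact ((hp.mono (hI.out hc hd)).integrableOn_isCompact isCompact_Icc).sub
    ((hq.mono (hI.out hc hd)).integrableOn_isCompact isCompact_Icc)

theorem UniversallyLocIntegrable.linearCombination {f g : ℝ → ℝ} {I : Set ℝ}
    (hf : UniversallyLocIntegrable f I) (hg : UniversallyLocIntegrable g I) (c₁ c₂ : ℝ) :
    UniversallyLocIntegrable (fun x => c₁ * f x + c₂ * g x) I :=
  fun c hc d hd μ _ => ((hf c hc d hd μ).const_mul c₁).add ((hg c hc d hd μ).const_mul c₂)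

theorem SMRepresents.real_sub {ν : SignedMeasure ℝ} {f : ℝ → ℝ} {c d : ℝ}
    (h : SMRepresents ν f c d) {x y : ℝ} (hx : x ∈ Icc c d) (hy : y ∈ Icc c d) (hxy : x ≤ y) :
    ν.toJordanDecomposition.posPart.real (Ioc x y) -
      ν.toJordanDecomposition.negPart.real (Ioc x y) = rightLim f y - rightLim f x := by
  rw [← h x hx y hy hxy, ν.apply_eq_posPart_real_sub_negPart_real measurableSet_Ioc]

theorem sInt_congr {ν ν' : SignedMeasure ℝ} {f g : ℝ → ℝ} {I : Set ℝ} {c d : ℝ}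
    (h : SMRepresents ν f c d) (h' : SMRepresents ν' f c d) (hc : c ∈ I) (hd : d ∈ I)
    (hg : UniversallyLocIntegrable g I) {E : Set ℝ} (hE : E ⊆ Ioc c d) (hEm : MeasurableSet E) :
    sInt ν g E = sInt ν' g E := by
  have hi : ∀ (μ : Measure ℝ) [IsFiniteMeasure μ], IntegrableOn g E μ := fun μ _ =>
    (hg c hc d hd μ).mono_set (hE.trans Ioc_subset_Icc_self)
  exact integral_sub_integral_eq_of_Ioc
    (fun x hx y hy hxy => (h.real_sub hx hy hxy).trans (h'.real_sub hx hy hxy).symm)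
    hE (hi _) (hi _) (hi _) (hi _) hEm

theorem sInt_linearCombination (ν : SignedMeasure ℝ) {f g : ℝ → ℝ} {E : Set ℝ}
    (hf : ∀ (μ : Measure ℝ) [IsFiniteMeasure μ], IntegrableOn f E μ)
    (hg : ∀ (μ : Measure ℝ) [IsFiniteMeasure μ], IntegrableOn g E μ) (c₁ c₂ : ℝ) :
    sInt ν (fun x => c₁ * f x + c₂ * g x) E = c₁ * sInt ν f E + c₂ * sInt ν g E := by
  have h : ∀ (μ : Measure ℝ) [IsFiniteMeasure μ], ∫ x in E, (c₁ * f x + c₂ * g x) ∂μ =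
      c₁ * (∫ x in E, f x ∂μ) + c₂ * ∫ x in E, g x ∂μ := fun μ _ => by
    rw [integral_add ((hf μ).const_mul c₁) ((hg μ).const_mul c₂), integral_const_mul,
      integral_const_mul]
  simp only [sInt, h]
  ring

theorem sInt_singleton (ν : SignedMeasure ℝ) (g : ℝ → ℝ) (x : ℝ) :
    sInt ν g {x} = g x * ν {x} := by
  rw [sInt, integral_singleton, integral_singleton,
    ν.apply_eq_posPart_real_sub_negPart_real (measurableSet_singleton x)]
  simp only [smul_eq_mul]
  ring

theorem SMRepresents.apply_singleton {ν : SignedMeasure ℝ} {f : ℝ → ℝ} {I : Set ℝ} {c d x : ℝ}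
    (h : SMRepresents ν f c d) (hf : HasOneSidedLims f I) (hx : x ∈ I) (hcx : c < x)
    (hxd : x ≤ d) : ν {x} = jump f x := by
  set P := ν.toJordanDecomposition.posPart
  set N := ν.toJordanDecomposition.negPart
  have hlim : ∀ (μ : Measure ℝ) [IsFiniteMeasure μ],
      Tendsto (fun y => μ.real (Ioc y x)) (𝓝[<] x) (𝓝 (μ.real {x})) := by
    intro μ _
    have h1 := (measureReal_Ioo_tendsto_zero μ x).add_const (μ.real {x})
    rw [zero_add] at h1
    refine h1.congr' ?_
    filter_upwards [self_mem_nhdsWithin] with y hy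
    rw [← measureReal_union (by simp) (measurableSet_singleton x), Ioo_union_right hy]
  have h1 := (hlim P).sub (hlim N)
  have h2 : Tendsto (fun y => rightLim f x - rightLim f y) (𝓝[<] x)
      (𝓝 (rightLim f x - leftLim f x)) := (hf.rightLim_left hx).const_sub _
  rw [ν.apply_eq_posPart_real_sub_negPart_real (measurableSet_singleton x)]
  refine tendsto_nhds_unique h1 (h2.congr' ?_)
  filter_upwards [Ioo_mem_nhdsLT hcx] with y hy
  exact (h.real_sub ⟨hy.1.le, hy.2.le.trans hxd⟩ ⟨hcx.le, hxd⟩ hy.2.le).symm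

section MeasureEqOn

variable {I : Set ℝ} {g k β : ℝ → ℝ}

theorem MeasureEqOn.exists_single (h : MeasureEqOn I g (fun _ : Fin 1 => k) (fun _ => β))
    {c d : ℝ} (hc : c ∈ I) (hd : d ∈ I) (hcd : c < d) :
    ∃ νg ν : SignedMeasure ℝ, SMRepresents νg g c d ∧ SMRepresents ν β c d ∧
      ∀ E : Set ℝ, E ⊆ Ioc c d → MeasurableSet E → νg E = sInt ν k E := by
  obtain ⟨νg, ν, h1, h2, h3⟩ := h c hc d hd hcd
  exact ⟨νg, ν 0, h1, h2 0, fun E hE hEm => by simpa using h3 E hE hEm⟩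

theorem MeasureEqOn.linearCombination {g' k' : ℝ → ℝ}
    (h : MeasureEqOn I g (fun _ : Fin 1 => k) (fun _ => β))
    (h' : MeasureEqOn I g' (fun _ : Fin 1 => k') (fun _ => β)) [hO : OrdConnected I]
    (hg : HasOneSidedLims g I) (hg' : HasOneSidedLims g' I)
    (hk : UniversallyLocIntegrable k I) (hk' : UniversallyLocIntegrable k' I) (c₁ c₂ : ℝ) :
    MeasureEqOn I (fun x => c₁ * g x + c₂ * g' x)
      (fun _ : Fin 1 => fun x => c₁ * k x + c₂ * k' x) (fun _ => β) := by
  intro c hc d hd hcd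
  obtain ⟨νg, ν, h1, h2, h3⟩ := h.exists_single hc hd hcd
  obtain ⟨νg', ν', h1', h2', h3'⟩ := h'.exists_single hc hd hcd
  refine ⟨c₁ • νg + c₂ • νg', fun _ => ν, ?_, fun _ => h2, ?_⟩
  · intro x hx y hy hxy
    have hxI := hO.out hc hd hx
    have hyI := hO.out hc hd hy
    rw [(hg.lims_linearCombination hg' c₁ c₂ hxI).2, (hg.lims_linearCombination hg' c₁ c₂ hyI).2]
    simp only [add_apply, smul_apply, smul_eq_mul,
      h1 x hx y hy hxy, h1' x hx y hy hxy]
    ring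
  · intro E hE hEm
    simp only [add_apply, smul_apply, smul_eq_mul,
      h3 E hE hEm, h3' E hE hEm, Finset.univ_unique, Finset.sum_const, Finset.card_singleton,
      one_smul]
    have hs := hE.trans Ioc_subset_Icc_self
    rw [sInt_linearCombination ν (fun μ _ => (hk c hc d hd μ).mono_set hs)
      (fun μ _ => (hk' c hc d hd μ).mono_set hs), sInt_congr h2' h2 hc hd hk' hE hEm]

/-- The jump relation for the solution of `dg = k dβ`. -/
theorem MeasureEqOn.jump_eq (hI : IsOpen I)
    (h : MeasureEqOn I g (fun _ : Fin 1 => k) (fun _ => β)) (hg : HasOneSidedLims g I)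
    (hβ : HasOneSidedLims β I) {x : ℝ} (hx : x ∈ I) :
    jump g x = k x * jump β x := by
  obtain ⟨c, d, hcd, hsub⟩ := mem_nhds_iff_exists_Ioo_subset.1 (hI.mem_nhds hx)
  obtain ⟨c', hc1, hc2⟩ := exists_between hcd.1
  obtain ⟨νg, ν, h1, h2, h3⟩ := h.exists_single (hsub ⟨hc1, hc2.trans hcd.2⟩) hx hc2
  have h4 := h3 {x} (by simp [hc2]) (measurableSet_singleton x)
  rwa [sInt_singleton, h1.apply_singleton hg hx hc2 le_rfl,
    h2.apply_singleton hβ hx hc2 le_rfl] at h4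

/-- On compact subintervals, increments of the solution of `dg = k dβ` are bounded by a finite
measure times a bound of `k`. -/
theorem MeasureEqOn.exists_increment_bound
    (h : MeasureEqOn I g (fun _ : Fin 1 => k) (fun _ => β)) {c d : ℝ} (hc : c ∈ I) (hd : d ∈ I)
    (hcd : c < d) :
    ∃ μ : Measure ℝ, IsFiniteMeasure μ ∧ ∀ p q M : ℝ, c ≤ p → p ≤ q → q ≤ d →
      (∀ x ∈ Ioc p q, |k x| ≤ M) → |rightLim g q - rightLim g p| ≤ M * μ.real (Ioc p q) := by
  obtain ⟨νg, ν, h1, h2, h3⟩ := h.exists_single hc hd hcd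
  set P := ν.toJordanDecomposition.posPart
  set N := ν.toJordanDecomposition.negPart
  refine ⟨P + N, inferInstance, fun p q M hp hpq hq hM => ?_⟩
  rw [← h1 p ⟨hp, hpq.trans hq⟩ q ⟨hp.trans hpq, hq⟩ hpq,
    h3 _ (Ioc_subset_Ioc hp hq) measurableSet_Ioc, measureReal_add_apply, mul_add]
  have hP : ‖∫ x in Ioc p q, k x ∂P‖ ≤ M * P.real (Ioc p q) :=
    norm_setIntegral_le_of_norm_le_const (measure_lt_top P _) (fun x hx => hM x hx)
  have hN : ‖∫ x in Ioc p q, k x ∂N‖ ≤ M * N.real (Ioc p q) :=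
    norm_setIntegral_le_of_norm_le_const (measure_lt_top N _) (fun x hx => hM x hx)
  exact (norm_sub_le _ _).trans (add_le_add hP hN)

/-- If `k` is bounded below by `η` and `α` is monotone, then increments of the solution of
`dg = k dα` are bounded below by `η` times the increments of `α`. -/
theorem MeasureEqOn.increment_ge {α : ℝ → ℝ} (hI : IsOpen I) [hO : OrdConnected I]
    (h : MeasureEqOn I g (fun _ : Fin 1 => k) (fun _ => α)) (hk : UniversallyLocIntegrable k I)
    (hα : MonotoneOn α I) (hαl : HasOneSidedLims α I) {p q η : ℝ} (hp : p ∈ I) (hq : q ∈ I)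
    (hpq : p < q) (hη : ∀ x ∈ Ioc p q, η ≤ k x) :
    η * (rightLim α q - rightLim α p) ≤ rightLim g q - rightLim g p := by
  obtain ⟨c, e, hce, hsub⟩ := mem_nhds_iff_exists_Ioo_subset.1 (hI.mem_nhds hp)
  obtain ⟨c', hc1, hc2⟩ := exists_between hce.1
  have hc' : c' ∈ I := hsub ⟨hc1, hc2.trans hce.2⟩
  obtain ⟨e', d, hde, hsub'⟩ := mem_nhds_iff_exists_Ioo_subset.1 (hI.mem_nhds hq)
  obtain ⟨d', hd1, hd2⟩ := exists_between hde.2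
  have hd' : d' ∈ I := hsub' ⟨hde.1.trans hd1, hd2⟩
  have hcd' : c' ≤ d' := (hc2.trans (hpq.trans hd1)).le
  have hmono : Monotone fun x => α (max c' (min d' x)) := by
    have hm : ∀ x, max c' (min d' x) ∈ I := fun x =>
      hO.out hc' hd' ⟨le_max_left _ _, max_le hcd' (min_le_left _ _)⟩
    exact fun x y hxy => hα (hm x) (hm y) (max_le_max_left _ (min_le_min_left _ hxy))
  have hlim : ∀ x ∈ Icc p q, rightLim (fun x => α (max c' (min d' x))) x = rightLim α x := by
    intro x hx
    refine rightLim_eq_of_tendsto ((hαl x (hO.out hp hq hx)).2.congr' ?_)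
    filter_upwards [Ioo_mem_nhdsGT (hx.2.trans_lt hd1)] with y hy
    rw [min_eq_right hy.2.le, max_eq_right (hc2.le.trans (hx.1.trans hy.1.le))]
  set σ := hmono.stieltjesFunction.measure.restrict (Ioc p q) with hσ
  have hfin : IsFiniteMeasure σ := ⟨by simp [hσ]⟩
  obtain ⟨νg, ν, h1, h2, h3⟩ := h.exists_single hp hq hpq
  have hi : ∀ (μ : Measure ℝ) [IsFiniteMeasure μ], IntegrableOn k (Ioc p q) μ := fun μ _ =>
    (hk p hp q hq μ).mono_set Ioc_subset_Icc_self
  have hreal : ∀ x ∈ Icc p q, ∀ y ∈ Icc p q, x ≤ y →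
      σ.real (Ioc x y) = rightLim α y - rightLim α x := by
    intro x hx y hy hxy
    rw [hσ, measureReal_restrict_apply measurableSet_Ioc,
      inter_eq_self_of_subset_left (Ioc_subset_Ioc hx.1 hy.2), measureReal_def,
      StieltjesFunction.measure_Ioc, ENNReal.toReal_ofReal (sub_nonneg.2
        (hmono.stieltjesFunction.mono hxy)), hmono.stieltjesFunction_eq,
      hmono.stieltjesFunction_eq, hlim x hx, hlim y hy]
  have h4 : sInt ν k (Ioc p q) = ∫ x in Ioc p q, k x ∂σ := by
    have h5 := integral_sub_integral_eq_of_Ioc (P := ν.toJordanDecomposition.posPart)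
      (N := ν.toJordanDecomposition.negPart) (P' := σ) (N' := 0) (c := p) (d := q) (g := k)
      (fun x hx y hy hxy => by
        rw [h2.real_sub hx hy hxy, hreal x hx y hy hxy]
        simp) subset_rfl (hi _) (hi _) (hi _) (hi _) measurableSet_Ioc
    simpa [sInt] using h5
  have hpm : p ∈ Icc p q := left_mem_Icc.2 hpq.le
  have hqm : q ∈ Icc p q := right_mem_Icc.2 hpq.le
  rw [← h1 p hpm q hqm hpq.le, h3 _ subset_rfl measurableSet_Ioc, h4,
    ← hreal p hpm q hqm hpq.le]
  have h6 := setIntegral_mono_on (μ := σ) (f := fun _ => η) (g := k) (s := Ioc p q)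
    (integrable_const η) (hi σ) measurableSet_Ioc hη
  rwa [setIntegral_const, smul_eq_mul, mul_comm] at h6

end MeasureEqOn

/-- The standing assumptions on the coefficients of `-d(dy/dα) + y dβ = 0` on `I`. -/
structure RegularCoefficients (I : Set ℝ) (r : ℝ) (α β : ℝ → ℝ) : Prop where
  isOpen : IsOpen I
  ordConnected : OrdConnected I
  mem_Icc : r ∈ Icc (0 : ℝ) 1
  strictMonoOn : StrictMonoOn α I
  lims_left : HasOneSidedLims α I
  lims_right : HasOneSidedLims β I
  theta_one_sub_ne : ∀ x ∈ I, theta α β (1 - r) x ≠ 0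
  theta_ne : ∀ x ∈ I, theta α β r x ≠ 0

/-- The properties of a balanced solution `y`, with `w = dy/dα`, which are used below. -/
structure BalancedSolution (I : Set ℝ) (r : ℝ) (α β y w : ℝ → ℝ) : Prop where
  lims : HasOneSidedLims y I
  lims' : HasOneSidedLims w I
  balanced : ∀ x ∈ I, y x = r * leftLim y x + (1 - r) * rightLim y x
  balanced' : ∀ x ∈ I, w x = r * leftLim w x + (1 - r) * rightLim w x
  integrable : UniversallyLocIntegrable y I
  integrable' : UniversallyLocIntegrable w I
  eqn : MeasureEqOn I y (fun _ : Fin 1 => w) (fun _ => α)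
  eqn' : MeasureEqOn I w (fun _ : Fin 1 => y) (fun _ => β)

theorem IsHomSol.balancedSolution {I : Set ℝ} {r : ℝ} {α β y w : ℝ → ℝ} (hI : IsOpen I)
    [OrdConnected I] (h : IsHomSol I r α β y w) : BalancedSolution I r α β y w where
  lims := .of_locallyBoundedVariationOn hI h.1.1
  lims' := .of_locallyBoundedVariationOn hI h.2.1.1
  balanced := h.1.2
  balanced' := h.2.1.2
  integrable := .of_locallyBoundedVariationOn h.1.1
  integrable' := .of_locallyBoundedVariationOn h.2.1.1
  eqn := h.2.2.1
  eqn' := h.2.2.2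

theorem eqOn_zero_of_contraction {f g : ℝ → ℝ} {S : Set ℝ} {M : ℝ}
    (hM : ∀ x ∈ S, |f x| ≤ M ∧ |g x| ≤ M)
    (h : ∀ M : ℝ, (∀ x ∈ S, |f x| ≤ M ∧ |g x| ≤ M) → ∀ x ∈ S, |f x| ≤ M / 2 ∧ |g x| ≤ M / 2) :
    ∀ x ∈ S, f x = 0 ∧ g x = 0 := by
  have hn : ∀ n : ℕ, ∀ x ∈ S, |f x| ≤ M / 2 ^ n ∧ |g x| ≤ M / 2 ^ n := by
    intro n
    induction n with
    | zero => simpa using hM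
    | succ n ih =>
      have := h _ ih
      rwa [div_div, ← pow_succ] at this
  have hlim : Tendsto (fun n : ℕ => M / 2 ^ n) atTop (𝓝 0) := by
    have := (tendsto_pow_atTop_nhds_zero_of_lt_one (r := (1 / 2 : ℝ)) (by norm_num)
      (by norm_num)).const_mul M
    simpa [div_eq_mul_inv] using this
  intro x hx
  exact ⟨abs_nonpos_iff.1 (ge_of_tendsto' hlim fun n => (hn n x hx).1),
    abs_nonpos_iff.1 (ge_of_tendsto' hlim fun n => (hn n x hx).2)⟩

namespace BalancedSolution

variable {I : Set ℝ} {r : ℝ} {α β y w : ℝ → ℝ} {x : ℝ}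

theorem linearCombination [OrdConnected I] {y' w' : ℝ → ℝ} (h : BalancedSolution I r α β y w)
    (h' : BalancedSolution I r α β y' w') (c₁ c₂ : ℝ) :
    BalancedSolution I r α β (fun x => c₁ * y x + c₂ * y' x) (fun x => c₁ * w x + c₂ * w' x) where
  lims := fun x hx => by
    rw [(h.lims.lims_linearCombination h'.lims c₁ c₂ hx).1,
      (h.lims.lims_linearCombination h'.lims c₁ c₂ hx).2]
    exact ⟨((h.lims x hx).1.const_mul c₁).add ((h'.lims x hx).1.const_mul c₂),
      ((h.lims x hx).2.const_mul c₁).add ((h'.lims x hx).2.const_mul c₂)⟩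
  lims' := fun x hx => by
    rw [(h.lims'.lims_linearCombination h'.lims' c₁ c₂ hx).1,
      (h.lims'.lims_linearCombination h'.lims' c₁ c₂ hx).2]
    exact ⟨((h.lims' x hx).1.const_mul c₁).add ((h'.lims' x hx).1.const_mul c₂),
      ((h.lims' x hx).2.const_mul c₁).add ((h'.lims' x hx).2.const_mul c₂)⟩
  balanced := fun x hx => by
    rw [(h.lims.lims_linearCombination h'.lims c₁ c₂ hx).1,
      (h.lims.lims_linearCombination h'.lims c₁ c₂ hx).2, h.balanced x hx, h'.balanced x hx]
    ring
  balanced' := fun x hx => by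
    rw [(h.lims'.lims_linearCombination h'.lims' c₁ c₂ hx).1,
      (h.lims'.lims_linearCombination h'.lims' c₁ c₂ hx).2, h.balanced' x hx, h'.balanced' x hx]
    ring
  integrable := h.integrable.linearCombination h'.integrable c₁ c₂
  integrable' := h.integrable'.linearCombination h'.integrable' c₁ c₂
  eqn := h.eqn.linearCombination h'.eqn h.lims h'.lims h.integrable' h'.integrable' c₁ c₂
  eqn' := h.eqn'.linearCombination h'.eqn' h.lims' h'.lims' h.integrable h'.integrable c₁ c₂

theorem neg [OrdConnected I] (h : BalancedSolution I r α β y w) :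
    BalancedSolution I r α β (fun x => -y x) (fun x => -w x) := by
  simpa using h.linearCombination h (-1) 0

theorem leftLim_neg (h : BalancedSolution I r α β y w) (hx : x ∈ I) :
    leftLim (fun x => -y x) x = -leftLim y x :=
  leftLim_eq_of_tendsto (h.lims x hx).1.neg

theorem rightLim_neg (h : BalancedSolution I r α β y w) (hx : x ∈ I) :
    rightLim (fun x => -y x) x = -rightLim y x :=
  rightLim_eq_of_tendsto (h.lims x hx).2.neg

theorem leftLim_eq (h : BalancedSolution I r α β y w) (hc : RegularCoefficients I r α β)
    (hx : x ∈ I) : leftLim y x = y x - (1 - r) * (w x * jump α x) := by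
  have h1 := h.eqn.jump_eq hc.isOpen h.lims hc.lims_left hx
  rw [← h1, jump]
  linear_combination -h.balanced x hx

theorem rightLim_eq (h : BalancedSolution I r α β y w) (hc : RegularCoefficients I r α β)
    (hx : x ∈ I) : rightLim y x = y x + r * (w x * jump α x) := by
  have h1 := h.eqn.jump_eq hc.isOpen h.lims hc.lims_left hx
  rw [← h1, jump]
  linear_combination -h.balanced x hx

theorem leftLim_eq' (h : BalancedSolution I r α β y w) (hc : RegularCoefficients I r α β)
    (hx : x ∈ I) : leftLim w x = w x - (1 - r) * (y x * jump β x) := by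
  have h1 := h.eqn'.jump_eq hc.isOpen h.lims' hc.lims_right hx
  rw [← h1, jump]
  linear_combination -h.balanced' x hx

theorem rightLim_eq' (h : BalancedSolution I r α β y w) (hc : RegularCoefficients I r α β)
    (hx : x ∈ I) : rightLim w x = w x + r * (y x * jump β x) := by
  have h1 := h.eqn'.jump_eq hc.isOpen h.lims' hc.lims_right hx
  rw [← h1, jump]
  linear_combination -h.balanced' x hx

theorem eq_zero_of_leftLim (h : BalancedSolution I r α β y w) (hc : RegularCoefficients I r α β)
    (hx : x ∈ I) (h0 : leftLim y x = 0) (h0' : leftLim w x = 0) : y x = 0 ∧ w x = 0 := by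
  have h1 := h.leftLim_eq hc hx
  have h2 := h.leftLim_eq' hc hx
  rw [h0] at h1
  rw [h0'] at h2
  have h3 : theta α β (1 - r) x * y x = 0 := by
    rw [theta]
    linear_combination -h1 - (1 - r) * jump α x * h2
  have h4 : y x = 0 := (mul_eq_zero.1 h3).resolve_left (hc.theta_one_sub_ne x hx)
  exact ⟨h4, by rw [h4] at h2; linarith⟩

theorem eq_zero_of_rightLim (h : BalancedSolution I r α β y w) (hc : RegularCoefficients I r α β)
    (hx : x ∈ I) (h0 : rightLim y x = 0) (h0' : rightLim w x = 0) : y x = 0 ∧ w x = 0 := by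
  have h1 := h.rightLim_eq hc hx
  have h2 := h.rightLim_eq' hc hx
  rw [h0] at h1
  rw [h0'] at h2
  have h3 : theta α β r x * y x = 0 := by
    rw [theta]
    linear_combination -h1 + r * jump α x * h2
  have h4 : y x = 0 := (mul_eq_zero.1 h3).resolve_left (hc.theta_ne x hx)
  exact ⟨h4, by rw [h4] at h2; linarith⟩

theorem lims_eq_zero (h : BalancedSolution I r α β y w) (hc : RegularCoefficients I r α β)
    (hx : x ∈ I) (h0 : y x = 0) (h0' : w x = 0) :
    leftLim y x = 0 ∧ leftLim w x = 0 ∧ rightLim y x = 0 ∧ rightLim w x = 0 := by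
  simp [h.leftLim_eq hc hx, h.leftLim_eq' hc hx, h.rightLim_eq hc hx, h.rightLim_eq' hc hx, h0, h0']

theorem abs_le_of_lims {f : ℝ → ℝ} {M : ℝ} (hr : r ∈ Icc (0 : ℝ) 1)
    (hf : f x = r * leftLim f x + (1 - r) * rightLim f x) (hl : |leftLim f x| ≤ M)
    (hr' : |rightLim f x| ≤ M) : |f x| ≤ M := by
  rw [hf]
  rw [abs_le] at *
  have h1 := hr.1
  have h2 := sub_nonneg.2 hr.2
  constructor <;> nlinarith

/-- If the right limits contract on an interval, then the solution vanishes there. -/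
theorem eqOn_zero_of_rightLim_contraction (h : BalancedSolution I r α β y w)
    (hr : r ∈ Icc (0 : ℝ) 1) {c d M : ℝ} (hI : Ioo c d ⊆ I)
    (hM : ∀ x ∈ Ioo c d, |y x| ≤ M ∧ |w x| ≤ M)
    (hstep : ∀ M : ℝ, (∀ x ∈ Ioo c d, |y x| ≤ M ∧ |w x| ≤ M) →
      ∀ x ∈ Ioo c d, |rightLim y x| ≤ M / 2 ∧ |rightLim w x| ≤ M / 2) :
    ∀ x ∈ Ioo c d, y x = 0 ∧ w x = 0 := by
  refine eqOn_zero_of_contraction hM fun M hM x hx => ?_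
  have h1 := hstep M hM
  have hev : ∀ᶠ z in 𝓝[<] x, z ∈ Ioo c d := by
    filter_upwards [Ioo_mem_nhdsLT hx.1] with z hz using ⟨hz.1, hz.2.trans hx.2⟩
  refine ⟨abs_le_of_lims hr (h.balanced x (hI hx)) ?_ (h1 x hx).1,
    abs_le_of_lims hr (h.balanced' x (hI hx)) ?_ (h1 x hx).2⟩
  · exact le_of_tendsto (h.lims.rightLim_left (hI hx)).abs (hev.mono fun z hz => (h1 z hz).1)
  · exact le_of_tendsto (h.lims'.rightLim_left (hI hx)).abs (hev.mono fun z hz => (h1 z hz).2)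

theorem exists_bound_of_tendsto {f g : ℝ → ℝ} {l : Filter ℝ} {A B : ℝ}
    (hf : Tendsto f l (𝓝 A)) (hg : Tendsto g l (𝓝 B)) :
    ∃ M : ℝ, ∀ᶠ x in l, |f x| ≤ M ∧ |g x| ≤ M := by
  refine ⟨max |A| |B| + 1, ?_⟩
  have h1 := hf.abs.eventually_lt_const (lt_add_one |A|)
  have h2 := hg.abs.eventually_lt_const (lt_add_one |B|)
  filter_upwards [h1, h2] with x h1 h2
  exact ⟨h1.le.trans (by gcongr; exact le_max_left _ _),
    h2.le.trans (by gcongr; exact le_max_right _ _)⟩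

theorem eventually_eq_zero_right (h : BalancedSolution I r α β y w)
    (hc : RegularCoefficients I r α β) (hx : x ∈ I) (h0 : rightLim y x = 0)
    (h0' : rightLim w x = 0) : ∀ᶠ z in 𝓝[>] x, y z = 0 ∧ w z = 0 := by
  have := hc.ordConnected
  obtain ⟨e, d, hde, hsub⟩ := mem_nhds_iff_exists_Ioo_subset.1 (hc.isOpen.mem_nhds hx)
  obtain ⟨d', hd1, hd2⟩ := exists_between hde.2
  have hd' : d' ∈ I := hsub ⟨hde.1.trans hd1, hd2⟩
  obtain ⟨μ, _, hμ⟩ := h.eqn.exists_increment_bound hx hd' hd1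
  obtain ⟨ν, _, hν⟩ := h.eqn'.exists_increment_bound hx hd' hd1
  obtain ⟨M, hM⟩ := exists_bound_of_tendsto (h.lims x hx).2 (h.lims' x hx).2
  have hev := (((measureReal_Ioc_tendsto_zero μ x).eventually_le_const one_half_pos).and
    ((measureReal_Ioc_tendsto_zero ν x).eventually_le_const one_half_pos)).and
    (hM.and (Ioo_mem_nhdsGT hd1))
  obtain ⟨q, hq, hq'⟩ := mem_nhdsGT_iff_exists_Ioo_subset.1 hev
  have hz := h.eqOn_zero_of_rightLim_contraction hc.mem_Icc (c := x) (d := q)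
    (fun z hz => this.out hx hd' (Ioo_subset_Icc_self (hq' hz).2.2)) (fun z hz => (hq' hz).2.1) ?_
  · filter_upwards [Ioo_mem_nhdsGT hq] with z hz' using hz z hz'
  · intro M hM z hz
    have hM0 : 0 ≤ M := (abs_nonneg _).trans (hM z hz).1
    have hmem : ∀ a ∈ Ioc x z, a ∈ Ioo x q := fun a ha => ⟨ha.1, ha.2.trans_lt hz.2⟩
    have h1 := hμ x z M le_rfl hz.1.le (hq' hz).2.2.2.le fun a ha => (hM a (hmem a ha)).2
    have h2 := hν x z M le_rfl hz.1.le (hq' hz).2.2.2.le fun a ha => (hM a (hmem a ha)).1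
    rw [h0, sub_zero] at h1
    rw [h0', sub_zero] at h2
    have h3 := mul_le_mul_of_nonneg_left (hq' hz).1.1 hM0
    have h4 := mul_le_mul_of_nonneg_left (hq' hz).1.2 hM0
    constructor <;> linarith

theorem eventually_eq_zero_left (h : BalancedSolution I r α β y w)
    (hc : RegularCoefficients I r α β) (hx : x ∈ I) (h0 : leftLim y x = 0)
    (h0' : leftLim w x = 0) : ∀ᶠ z in 𝓝[<] x, y z = 0 ∧ w z = 0 := by
  have := hc.ordConnected
  obtain ⟨d, e, hde, hsub⟩ := mem_nhds_iff_exists_Ioo_subset.1 (hc.isOpen.mem_nhds hx)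
  obtain ⟨d', hd1, hd2⟩ := exists_between hde.1
  have hd' : d' ∈ I := hsub ⟨hd1, hd2.trans hde.2⟩
  obtain ⟨μ, _, hμ⟩ := h.eqn.exists_increment_bound hd' hx hd2
  obtain ⟨ν, _, hν⟩ := h.eqn'.exists_increment_bound hd' hx hd2
  obtain ⟨M, hM⟩ := exists_bound_of_tendsto (h.lims x hx).1 (h.lims' x hx).1
  have hev := (((measureReal_Ioo_tendsto_zero μ x).eventually_le_const one_half_pos).and
    ((measureReal_Ioo_tendsto_zero ν x).eventually_le_const one_half_pos)).and
    (hM.and (Ioo_mem_nhdsLT hd2))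
  obtain ⟨q, hq, hq'⟩ := mem_nhdsLT_iff_exists_Ioo_subset.1 hev
  have hz := h.eqOn_zero_of_rightLim_contraction hc.mem_Icc (c := q) (d := x)
    (fun z hz => this.out hd' hx (Ioo_subset_Icc_self (hq' hz).2.2)) (fun z hz => (hq' hz).2.1) ?_
  · filter_upwards [Ioo_mem_nhdsLT hq] with z hz' using hz z hz'
  · intro M hM z hz
    have hM0 : 0 ≤ M := (abs_nonneg _).trans (hM z hz).1
    have key : ∀ {g : ℝ → ℝ} (ρ : Measure ℝ) [IsFiniteMeasure ρ], HasOneSidedLims g I →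
        leftLim g x = 0 → ρ.real (Ioo z x) ≤ 1 / 2 →
        (∀ a, z ≤ a → a < x → |rightLim g a - rightLim g z| ≤ M * ρ.real (Ioc z a)) →
        |rightLim g z| ≤ M / 2 := by
      intro g ρ _ hg hg0 hρ hb
      have hl := ((hg.rightLim_left hx).sub_const (rightLim g z)).abs
      rw [hg0, zero_sub, abs_neg] at hl
      refine le_of_tendsto hl ?_
      filter_upwards [Ioo_mem_nhdsLT hz.2] with a ha
      have h5 : ρ.real (Ioc z a) ≤ ρ.real (Ioo z x) :=
        measureReal_mono fun b hb => ⟨hb.1, hb.2.trans_lt ha.2⟩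
      have h6 := mul_le_mul_of_nonneg_left (h5.trans hρ) hM0
      linarith [hb a ha.1.le ha.2]
    have hmem : ∀ a < x, ∀ b ∈ Ioc z a, b ∈ Ioo q x := fun a ha b hb =>
      ⟨hz.1.trans hb.1, hb.2.trans_lt ha⟩
    exact ⟨key μ h.lims h0 (hq' hz).1.1 fun a ha hax => hμ z a M (hq' hz).2.2.1.le ha hax.le
        fun b hb => (hM b (hmem a hax b hb)).2,
      key ν h.lims' h0' (hq' hz).1.2 fun a ha hax => hν z a M (hq' hz).2.2.1.le ha hax.le
        fun b hb => (hM b (hmem a hax b hb)).1⟩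

/-- Vanishing initial data propagate through the interval. -/
theorem eqOn_zero (h : BalancedSolution I r α β y w) (hc : RegularCoefficients I r α β)
    (hx : x ∈ I) (h0 : y x = 0) (h0' : w x = 0) : ∀ z ∈ I, y z = 0 ∧ w z = 0 := by
  intro z hz
  have := hc.ordConnected
  have hI : IsPreconnected I := this.isPreconnected
  suffices hs : (y x = 0 ∧ w x = 0) ↔ (y z = 0 ∧ w z = 0) from hs.1 ⟨h0, h0'⟩
  refine hI.induction₂ (fun x z => (y x = 0 ∧ w x = 0) ↔ (y z = 0 ∧ w z = 0)) ?_
      (fun _ _ _ _ _ _ h1 h2 => h1.trans h2) (fun _ _ _ _ h1 => h1.symm) hx hz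
  intro x hx
  refine Filter.Eventually.filter_mono nhdsWithin_le_nhds ?_
  rw [← nhdsNE_sup_pure, ← nhdsLT_sup_nhdsGT, eventually_sup, eventually_sup, eventually_pure]
  by_cases hz : y x = 0 ∧ w x = 0
  · obtain ⟨h1, h2, h3, h4⟩ := h.lims_eq_zero hc hx hz.1 hz.2
    exact ⟨⟨(h.eventually_eq_zero_left hc hx h1 h2).mono fun a ha => by simp only [hz, ha],
      (h.eventually_eq_zero_right hc hx h3 h4).mono fun a ha => by simp only [hz, ha]⟩, Iff.rfl⟩
  · refine ⟨⟨?_, ?_⟩, Iff.rfl⟩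
    · have h1 : ¬ (leftLim y x = 0 ∧ leftLim w x = 0) := fun hh =>
        hz (h.eq_zero_of_leftLim hc hx hh.1 hh.2)
      have hev : ∀ᶠ a in 𝓝[<] x, ¬ (y a = 0 ∧ w a = 0) := by
        by_cases h2 : leftLim y x = 0
        · exact ((h.lims' x hx).1.eventually_ne fun h3 => h1 ⟨h2, h3⟩).mono fun a ha hh => ha hh.2
        · exact ((h.lims x hx).1.eventually_ne h2).mono fun a ha hh => ha hh.1
      exact hev.mono fun a ha => iff_of_false hz ha
    · have h1 : ¬ (rightLim y x = 0 ∧ rightLim w x = 0) := fun hh =>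
        hz (h.eq_zero_of_rightLim hc hx hh.1 hh.2)
      have hev : ∀ᶠ a in 𝓝[>] x, ¬ (y a = 0 ∧ w a = 0) := by
        by_cases h2 : rightLim y x = 0
        · exact ((h.lims' x hx).2.eventually_ne fun h3 => h1 ⟨h2, h3⟩).mono fun a ha hh => ha hh.2
        · exact ((h.lims x hx).2.eventually_ne h2).mono fun a ha hh => ha hh.1
      exact hev.mono fun a ha => iff_of_false hz ha

end BalancedSolution

/-- The Wronskian of `u` and `v`, with `wu = du/dα` and `wv = dv/dα`. -/
def wronskian (u wu v wv : ℝ → ℝ) (x : ℝ) : ℝ := u x * wv x - v x * wu x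

namespace RegularCoefficients

variable {I : Set ℝ} {r : ℝ} {α β : ℝ → ℝ} {x z : ℝ}

theorem eventually_mem_left (hc : RegularCoefficients I r α β) (hx : x ∈ I) :
    ∀ᶠ z in 𝓝[<] x, z ∈ I :=
  nhdsWithin_le_nhds (hc.isOpen.mem_nhds hx)

theorem eventually_mem_right (hc : RegularCoefficients I r α β) (hx : x ∈ I) :
    ∀ᶠ z in 𝓝[>] x, z ∈ I :=
  nhdsWithin_le_nhds (hc.isOpen.mem_nhds hx)

theorem leftLim_le (hc : RegularCoefficients I r α β) (hx : x ∈ I) (hz : z ∈ I) (h : x ≤ z) :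
    leftLim α x ≤ α z := by
  refine le_of_tendsto (hc.lims_left x hx).1 ?_
  filter_upwards [hc.eventually_mem_left hx, self_mem_nhdsWithin] with y hy hyx
  exact hc.strictMonoOn.monotoneOn hy hz ((mem_Iio.1 hyx).le.trans h)

theorem le_rightLim (hc : RegularCoefficients I r α β) (hx : x ∈ I) (hz : z ∈ I) (h : z ≤ x) :
    α z ≤ rightLim α x := by
  refine ge_of_tendsto (hc.lims_left x hx).2 ?_
  filter_upwards [hc.eventually_mem_right hx, self_mem_nhdsWithin] with y hy hyx
  exact hc.strictMonoOn.monotoneOn hz hy (h.trans (mem_Ioi.1 hyx).le)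

theorem rightLim_le (hc : RegularCoefficients I r α β) (hx : x ∈ I) (hz : z ∈ I) (h : x < z) :
    rightLim α x ≤ α z := by
  refine le_of_tendsto (hc.lims_left x hx).2 ?_
  filter_upwards [hc.eventually_mem_right hx, Ioo_mem_nhdsGT h] with y hy hyx
  exact hc.strictMonoOn.monotoneOn hy hz hyx.2.le

theorem le_leftLim (hc : RegularCoefficients I r α β) (hx : x ∈ I) (hz : z ∈ I) (h : z < x) :
    α z ≤ leftLim α x := by
  refine ge_of_tendsto (hc.lims_left x hx).1 ?_
  filter_upwards [hc.eventually_mem_left hx, Ioo_mem_nhdsLT h] with y hy hyx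
  exact hc.strictMonoOn.monotoneOn hz hy hyx.1.le

theorem jump_nonneg (hc : RegularCoefficients I r α β) (hx : x ∈ I) : 0 ≤ jump α x :=
  sub_nonneg.2 ((hc.leftLim_le hx hx le_rfl).trans (hc.le_rightLim hx hx le_rfl))

theorem rightLim_lt_leftLim (hc : RegularCoefficients I r α β) (hx : x ∈ I) (hz : z ∈ I)
    (h : x < z) : rightLim α x < leftLim α z := by
  have := hc.ordConnected
  obtain ⟨m, hm1, hm2⟩ := exists_between h
  obtain ⟨n, hn1, hn2⟩ := exists_between hm2
  have hm : m ∈ I := this.out hx hz ⟨hm1.le, hm2.le⟩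
  have hn : n ∈ I := this.out hx hz ⟨(hm1.trans hn1).le, hn2.le⟩
  exact (hc.rightLim_le hx hm hm1).trans_lt
    ((hc.strictMonoOn hm hn hn1).trans_le (hc.le_leftLim hz hn hn2))

end RegularCoefficients

namespace BalancedSolution

variable {I : Set ℝ} {r : ℝ} {α β y w u wu v wv : ℝ → ℝ} {x : ℝ}

theorem hasOneSidedLims_wronskian (hu : BalancedSolution I r α β u wu)
    (hv : BalancedSolution I r α β v wv) : HasOneSidedLims (wronskian u wu v wv) I :=
  (hu.lims.mul hv.lims').sub (hv.lims.mul hu.lims')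

theorem leftLim_wronskian (hu : BalancedSolution I r α β u wu)
    (hv : BalancedSolution I r α β v wv) (hx : x ∈ I) :
    leftLim (wronskian u wu v wv) x =
      leftLim u x * leftLim wv x - leftLim v x * leftLim wu x :=
  leftLim_eq_of_tendsto
    (((hu.lims x hx).1.mul (hv.lims' x hx).1).sub ((hv.lims x hx).1.mul (hu.lims' x hx).1))

theorem rightLim_wronskian (hu : BalancedSolution I r α β u wu)
    (hv : BalancedSolution I r α β v wv) (hx : x ∈ I) :
    rightLim (wronskian u wu v wv) x =
      rightLim u x * rightLim wv x - rightLim v x * rightLim wu x :=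
  rightLim_eq_of_tendsto
    (((hu.lims x hx).2.mul (hv.lims' x hx).2).sub ((hv.lims x hx).2.mul (hu.lims' x hx).2))

theorem leftLim_wronskian_eq_theta_mul (hu : BalancedSolution I r α β u wu)
    (hv : BalancedSolution I r α β v wv) (hc : RegularCoefficients I r α β) (hx : x ∈ I) :
    leftLim (wronskian u wu v wv) x = theta α β (1 - r) x * wronskian u wu v wv x := by
  rw [hu.leftLim_wronskian hv hx, hu.leftLim_eq hc hx, hu.leftLim_eq' hc hx, hv.leftLim_eq hc hx,
    hv.leftLim_eq' hc hx, theta, wronskian]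
  ring

theorem rightLim_wronskian_eq_theta_mul (hu : BalancedSolution I r α β u wu)
    (hv : BalancedSolution I r α β v wv) (hc : RegularCoefficients I r α β) (hx : x ∈ I) :
    rightLim (wronskian u wu v wv) x = theta α β r x * wronskian u wu v wv x := by
  rw [hu.rightLim_wronskian hv hx, hu.rightLim_eq hc hx, hu.rightLim_eq' hc hx,
    hv.rightLim_eq hc hx, hv.rightLim_eq' hc hx, theta, wronskian]
  ring

theorem cross_lims_eq_jump_mul_wronskian (hu : BalancedSolution I r α β u wu)
    (hv : BalancedSolution I r α β v wv) (hc : RegularCoefficients I r α β) (hx : x ∈ I) :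
    rightLim v x * leftLim u x - leftLim v x * rightLim u x =
      jump α x * wronskian u wu v wv x := by
  rw [hu.leftLim_eq hc hx, hu.rightLim_eq hc hx, hv.leftLim_eq hc hx, hv.rightLim_eq hc hx,
    wronskian]
  ring

theorem wronskian_ne_zero (hu : BalancedSolution I r α β u wu)
    (hv : BalancedSolution I r α β v wv) (hc : RegularCoefficients I r α β)
    (hind : ¬ LinDepOn I u v) (hx : x ∈ I) : wronskian u wu v wv x ≠ 0 := by
  intro h0
  rw [wronskian] at h0
  have := hc.ordConnected
  have key : ∀ c₁ c₂ : ℝ, ¬(c₁ = 0 ∧ c₂ = 0) → c₁ * u x + c₂ * v x = 0 →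
      c₁ * wu x + c₂ * wv x = 0 → False := fun c₁ c₂ hne h1 h2 =>
    hind ⟨c₁, c₂, hne, fun z hz =>
      ((hu.linearCombination hv c₁ c₂).eqOn_zero hc hx h1 h2 z hz).1⟩
  by_cases h1 : u x = 0
  · by_cases h2 : wu x = 0
    · exact key 1 0 (by simp) (by simp [h1]) (by simp [h2])
    · exact key (-wv x) (wu x) (fun h => h2 h.2) (by linarith) (by ring)
  · exact key (-v x) (u x) (fun h => h1 h.2) (by ring) (by linarith)

theorem eventually_pos_right (h : BalancedSolution I r α β y w)
    (hc : RegularCoefficients I r α β) (hx : x ∈ I) (h0 : rightLim y x = 0)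
    (hw : 0 < rightLim w x) : ∀ᶠ z in 𝓝[>] x, 0 < leftLim y z ∧ 0 < rightLim y z := by
  have := hc.ordConnected
  set η := rightLim w x / 2
  have hη : 0 < η := half_pos hw
  have hev := ((h.lims' x hx).2.eventually_const_le (half_lt_self hw)).and
    (hc.eventually_mem_right hx)
  obtain ⟨q, hq, hq'⟩ := mem_nhdsGT_iff_exists_Ioo_subset.1 hev
  have key : ∀ z ∈ Ioo x q, η * (rightLim α z - rightLim α x) ≤ rightLim y z := by
    intro z hz
    have h1 := h.eqn.increment_ge hc.isOpen h.integrable' hc.strictMonoOn.monotoneOn hc.lims_left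
      hx (hq' hz).2 hz.1 (η := η) fun b hb => (hq' ⟨hb.1, hb.2.trans_lt hz.2⟩).1
    rwa [h0, sub_zero] at h1
  filter_upwards [Ioo_mem_nhdsGT hq] with z hz
  have hzI := (hq' hz).2
  have h1 : 0 < leftLim α z - rightLim α x := sub_pos.2 (hc.rightLim_lt_leftLim hx hzI hz.1)
  have h2 : leftLim α z ≤ rightLim α z := sub_nonneg.1 (hc.jump_nonneg hzI)
  refine ⟨(mul_pos hη h1).trans_le ?_, (mul_pos hη (h1.trans_le (by linarith))).trans_le (key z hz)⟩
  refine le_of_tendsto_of_tendsto (((hc.lims_left.rightLim_left hzI).sub_const _).const_mul η)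
    (h.lims.rightLim_left hzI) ?_
  filter_upwards [Ioo_mem_nhdsLT hz.1] with a ha using key a ⟨ha.1, ha.2.trans hz.2⟩

theorem eventually_neg_left (h : BalancedSolution I r α β y w)
    (hc : RegularCoefficients I r α β) (hx : x ∈ I) (h0 : leftLim y x = 0)
    (hw : 0 < leftLim w x) : ∀ᶠ z in 𝓝[<] x, leftLim y z < 0 ∧ rightLim y z < 0 := by
  have := hc.ordConnected
  set η := leftLim w x / 2
  have hη : 0 < η := half_pos hw
  have hev := ((h.lims' x hx).1.eventually_const_le (half_lt_self hw)).and
    (hc.eventually_mem_left hx)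
  obtain ⟨q, hq, hq'⟩ := mem_nhdsLT_iff_exists_Ioo_subset.1 hev
  have key : ∀ z ∈ Ioo q x, η * (leftLim α x - rightLim α z) ≤ -rightLim y z := by
    intro z hz
    rw [← zero_sub, ← h0]
    refine le_of_tendsto_of_tendsto (((hc.lims_left.rightLim_left hx).sub_const _).const_mul η)
      ((h.lims.rightLim_left hx).sub_const _) ?_
    filter_upwards [Ioo_mem_nhdsLT hz.2] with a ha
    exact h.eqn.increment_ge hc.isOpen h.integrable' hc.strictMonoOn.monotoneOn hc.lims_left
      (hq' hz).2 (hq' ⟨hz.1.trans ha.1, ha.2⟩).2 ha.1 (η := η)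
      fun b hb => (hq' ⟨hz.1.trans hb.1, hb.2.trans_lt ha.2⟩).1
  filter_upwards [Ioo_mem_nhdsLT hq] with z hz
  have hzI := (hq' hz).2
  have h1 : 0 < leftLim α x - rightLim α z := sub_pos.2 (hc.rightLim_lt_leftLim hzI hx hz.2)
  have h2 : leftLim α z ≤ rightLim α z := sub_nonneg.1 (hc.jump_nonneg hzI)
  refine ⟨neg_pos.1 ((mul_pos hη (h1.trans_le
    (sub_le_sub_left h2 _))).trans_le ?_), neg_pos.1 ((mul_pos hη h1).trans_le (key z hz))⟩
  refine le_of_tendsto_of_tendsto (((hc.lims_left.rightLim_left hzI).const_sub _).const_mul η)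
    (h.lims.rightLim_left hzI).neg ?_
  filter_upwards [Ioo_mem_nhdsLT hz.1] with a ha using key a ⟨ha.1, ha.2.trans hz.2⟩

theorem eventually_neg_right (h : BalancedSolution I r α β y w)
    (hc : RegularCoefficients I r α β) (hx : x ∈ I) (h0 : rightLim y x = 0)
    (hw : rightLim w x < 0) : ∀ᶠ z in 𝓝[>] x, leftLim y z < 0 ∧ rightLim y z < 0 := by
  have := hc.ordConnected
  have h1 := h.neg.eventually_pos_right hc hx (by rw [h.rightLim_neg hx, h0, neg_zero])
    (by rw [rightLim_eq_of_tendsto (h.lims' x hx).2.neg]; exact neg_pos.2 hw)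
  filter_upwards [h1, hc.eventually_mem_right hx] with z hz hzI
  rwa [h.leftLim_neg hzI, h.rightLim_neg hzI, neg_pos, neg_pos] at hz

theorem eventually_pos_left (h : BalancedSolution I r α β y w)
    (hc : RegularCoefficients I r α β) (hx : x ∈ I) (h0 : leftLim y x = 0)
    (hw : leftLim w x < 0) : ∀ᶠ z in 𝓝[<] x, 0 < leftLim y z ∧ 0 < rightLim y z := by
  have := hc.ordConnected
  have h1 := h.neg.eventually_neg_left hc hx (by rw [h.leftLim_neg hx, h0, neg_zero])
    (by rw [leftLim_eq_of_tendsto (h.lims' x hx).1.neg]; exact neg_pos.2 hw)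
  filter_upwards [h1, hc.eventually_mem_left hx] with z hz hzI
  rwa [h.leftLim_neg hzI, h.rightLim_neg hzI, neg_lt_zero, neg_lt_zero] at hz

/-- To the right of any point, a nontrivial solution has a strict sign. -/
theorem eventually_pos_or_neg_right (h : BalancedSolution I r α β y w)
    (hc : RegularCoefficients I r α β) (hx : x ∈ I) (hne : ¬(y x = 0 ∧ w x = 0)) :
    (∀ᶠ z in 𝓝[>] x, 0 < leftLim y z ∧ 0 < rightLim y z) ∨
      ∀ᶠ z in 𝓝[>] x, leftLim y z < 0 ∧ rightLim y z < 0 := by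
  rcases lt_trichotomy (rightLim y x) 0 with h1 | h1 | h1
  · exact .inr (((h.lims.leftLim_right hx).eventually_lt_const h1).and
      ((h.lims.rightLim_right hx).eventually_lt_const h1))
  · rcases lt_trichotomy (rightLim w x) 0 with h2 | h2 | h2
    · exact .inr (h.eventually_neg_right hc hx h1 h2)
    · exact (hne (h.eq_zero_of_rightLim hc hx h1 h2)).elim
    · exact .inl (h.eventually_pos_right hc hx h1 h2)
  · exact .inl (((h.lims.leftLim_right hx).eventually_const_lt h1).and
      ((h.lims.rightLim_right hx).eventually_const_lt h1))

/-- To the left of any point, a nontrivial solution has a strict sign. -/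
theorem eventually_pos_or_neg_left (h : BalancedSolution I r α β y w)
    (hc : RegularCoefficients I r α β) (hx : x ∈ I) (hne : ¬(y x = 0 ∧ w x = 0)) :
    (∀ᶠ z in 𝓝[<] x, 0 < leftLim y z ∧ 0 < rightLim y z) ∨
      ∀ᶠ z in 𝓝[<] x, leftLim y z < 0 ∧ rightLim y z < 0 := by
  rcases lt_trichotomy (leftLim y x) 0 with h1 | h1 | h1
  · exact .inr (((h.lims.leftLim_left hx).eventually_lt_const h1).and
      ((h.lims.rightLim_left hx).eventually_lt_const h1))
  · rcases lt_trichotomy (leftLim w x) 0 with h2 | h2 | h2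
    · exact .inl (h.eventually_pos_left hc hx h1 h2)
    · exact (hne (h.eq_zero_of_leftLim hc hx h1 h2)).elim
    · exact .inr (h.eventually_neg_left hc hx h1 h2)
  · exact .inl (((h.lims.leftLim_left hx).eventually_const_lt h1).and
      ((h.lims.rightLim_left hx).eventually_const_lt h1))

end BalancedSolution

theorem changesSignAt_of_eventually {I : Set ℝ} (hI : IsOpen I) {y : ℝ → ℝ} {x : ℝ} (hx : x ∈ I)
    (h : ((∀ᶠ z in 𝓝[<] x, leftLim y z < 0) ∧ ∀ᶠ z in 𝓝[>] x, 0 < rightLim y z) ∨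
      ((∀ᶠ z in 𝓝[<] x, 0 < leftLim y z) ∧ ∀ᶠ z in 𝓝[>] x, rightLim y z < 0)) :
    ChangesSignAt I y x := by
  obtain ⟨ε, hε, hball⟩ := Metric.isOpen_iff.1 hI x hx
  rw [Real.ball_eq_Ioo] at hball
  have key : ∀ {p q : ℝ → Prop}, (∀ᶠ z in 𝓝[<] x, p z) → (∀ᶠ z in 𝓝[>] x, q z) →
      ∃ δ > 0, Ioo (x - δ) (x + δ) ⊆ I ∧ (∀ z ∈ Ioo (x - δ) x, p z) ∧
        ∀ z ∈ Ioo x (x + δ), q z := by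
    intro p q hp hq
    obtain ⟨c, hc, hc'⟩ := mem_nhdsLT_iff_exists_Ioo_subset.1 hp
    obtain ⟨d, hd, hd'⟩ := mem_nhdsGT_iff_exists_Ioo_subset.1 hq
    have hc0 : 0 < x - c := sub_pos.2 hc
    have hd0 : 0 < d - x := sub_pos.2 hd
    refine ⟨min ε (min (x - c) (d - x)), lt_min hε (lt_min hc0 hd0), ?_, ?_, ?_⟩
    · refine (Ioo_subset_Ioo ?_ ?_).trans hball
      · linarith [min_le_left ε (min (x - c) (d - x))]
      · linarith [min_le_left ε (min (x - c) (d - x))]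
    · intro z hz
      have h1 := (min_le_right ε (min (x - c) (d - x))).trans (min_le_left _ _)
      exact hc' ⟨by linarith [hz.1], hz.2⟩
    · intro z hz
      have h1 := (min_le_right ε (min (x - c) (d - x))).trans (min_le_right _ _)
      exact hd' ⟨hz.1, by linarith [hz.2]⟩
  rcases h with ⟨h1, h2⟩ | ⟨h1, h2⟩
  · obtain ⟨δ, hδ, hs, h3⟩ := key h1 h2
    exact ⟨δ, hδ, hs, .inl h3⟩
  · obtain ⟨δ, hδ, hs, h3⟩ := key h1 h2
    exact ⟨δ, hδ, hs, .inr h3⟩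

theorem eventually_eventually_nhdsNE {p : ℝ → Prop} {x : ℝ} (h : ∀ᶠ z in 𝓝[≠] x, p z) :
    ∀ᶠ z in 𝓝 x, ∀ᶠ z' in 𝓝[≠] z, p z' := by
  rw [← nhdsNE_sup_pure x, eventually_sup, eventually_pure]
  refine ⟨?_, h⟩
  filter_upwards [eventually_eventually_nhdsWithin.2 h, self_mem_nhdsWithin] with z hz hzx
  rw [isOpen_compl_singleton.nhdsWithin_eq hzx] at hz
  exact hz.filter_mono nhdsWithin_le_nhds

namespace BalancedSolution

variable {I : Set ℝ} {r : ℝ} {α β y w u wu v wv : ℝ → ℝ} {x : ℝ}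

/-- A nontrivial solution that does not change sign on a preconnected set has a weak sign. -/
theorem weak_sign_of_not_changesSignIn (h : BalancedSolution I r α β y w)
    (hc : RegularCoefficients I r α β) (hne : ∀ x ∈ I, ¬(y x = 0 ∧ w x = 0)) {J : Set ℝ}
    (hJ : IsPreconnected J) (hJI : J ⊆ I) (hns : ¬ ChangesSignIn I y J) :
    (∀ x ∈ J, 0 ≤ leftLim y x ∧ 0 ≤ rightLim y x) ∨
      (∀ x ∈ J, leftLim y x ≤ 0 ∧ rightLim y x ≤ 0) := by
  let Pos (x : ℝ) : Prop := ∀ᶠ z in 𝓝[≠] x, 0 < leftLim y z ∧ 0 < rightLim y z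
  let Neg (x : ℝ) : Prop := ∀ᶠ z in 𝓝[≠] x, leftLim y z < 0 ∧ rightLim y z < 0
  have hdich : ∀ x ∈ J, Pos x ∨ Neg x := by
    intro x hx
    have hn : ¬ ChangesSignAt I y x := fun hh => hns ⟨x, hx, hh⟩
    have hxI := hJI hx
    simp only [Pos, Neg, ← nhdsLT_sup_nhdsGT, eventually_sup]
    rcases h.eventually_pos_or_neg_left hc hxI (hne x hxI) with h1 | h1 <;>
      rcases h.eventually_pos_or_neg_right hc hxI (hne x hxI) with h2 | h2
    · exact .inl ⟨h1, h2⟩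
    · exact (hn (changesSignAt_of_eventually hc.isOpen hxI
        (.inr ⟨h1.mono fun _ h => h.1, h2.mono fun _ h => h.2⟩))).elim
    · exact (hn (changesSignAt_of_eventually hc.isOpen hxI
        (.inl ⟨h1.mono fun _ h => h.1, h2.mono fun _ h => h.2⟩))).elim
    · exact .inr ⟨h1, h2⟩
  have hexcl : ∀ x, Neg x → ¬ Pos x := by
    intro x h1 h2
    obtain ⟨z, hz1, hz2⟩ := (h1.and h2).exists
    exact hz1.1.not_gt hz2.1
  have hiff : ∀ x ∈ J, ∀ z ∈ J, (Pos x ↔ Pos z) := by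
    intro x hx z hz
    refine hJ.induction₂ (fun x z => (Pos x ↔ Pos z)) ?_
      (fun _ _ _ _ _ _ h1 h2 => h1.trans h2) (fun _ _ _ _ h1 => h1.symm) hx hz
    intro x hx
    refine Filter.Eventually.filter_mono nhdsWithin_le_nhds ?_
    rcases hdich x hx with h1 | h1
    · exact (eventually_eventually_nhdsNE h1).mono fun z hz => iff_of_true h1 hz
    · exact (eventually_eventually_nhdsNE h1).mono fun z hz =>
        iff_of_false (hexcl x h1) (hexcl z hz)
  by_cases hex : ∃ x ∈ J, Pos x
  · obtain ⟨x, hx, hpos⟩ := hex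
    refine .inl fun z hz => ?_
    have h1 : Pos z := (hiff x hx z hz).1 hpos
    simp only [Pos, ← nhdsLT_sup_nhdsGT, eventually_sup] at h1
    exact ⟨ge_of_tendsto (h.lims.leftLim_left (hJI hz)) (h1.1.mono fun _ h => h.1.le),
      ge_of_tendsto (h.lims.rightLim_right (hJI hz)) (h1.2.mono fun _ h => h.2.le)⟩
  · push Not at hex
    refine .inr fun z hz => ?_
    have h1 : Neg z := (hdich z hz).resolve_left (hex z hz)
    simp only [Neg, ← nhdsLT_sup_nhdsGT, eventually_sup] at h1
    exact ⟨le_of_tendsto (h.lims.leftLim_left (hJI hz)) (h1.1.mono fun _ h => h.1.le),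
      le_of_tendsto (h.lims.rightLim_right (hJI hz)) (h1.2.mono fun _ h => h.2.le)⟩

theorem jump_pos_of_lims_ne (h : BalancedSolution I r α β y w)
    (hc : RegularCoefficients I r α β) (hx : x ∈ I) (hne : leftLim y x ≠ rightLim y x) :
    0 < jump α x := by
  refine (hc.jump_nonneg hx).lt_of_ne fun h0 => hne ?_
  rw [h.leftLim_eq hc hx, h.rightLim_eq hc hx, ← h0]
  ring

theorem jump_eq_zero_of_lims_eq_zero (hu : BalancedSolution I r α β u wu)
    (hc : RegularCoefficients I r α β) (hx : x ∈ I) (hW : wronskian u wu v wv x ≠ 0)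
    (hl : leftLim u x = 0) (hr : rightLim u x = 0) : jump α x = 0 := by
  have h1 := hu.balanced x hx
  rw [hl, hr, mul_zero, mul_zero, add_zero] at h1
  have h2 : wu x ≠ 0 := fun h0 => hW (by simp [wronskian, h0, h1])
  have h3 := hu.eqn.jump_eq hc.isOpen hu.lims hc.lims_left hx
  rw [jump, hl, hr, sub_zero] at h3
  exact (mul_eq_zero.1 h3.symm).resolve_left h2

/-- The sign of the Wronskian at a point where `u` passes from nonpositive to nonnegative. -/
theorem wronskian_sign_of_nonpos_of_nonneg (hu : BalancedSolution I r α β u wu)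
    (hv : BalancedSolution I r α β v wv) (hc : RegularCoefficients I r α β) (hx : x ∈ I)
    (hl : leftLim u x ≤ 0) (hr : 0 ≤ rightLim u x) (hW : 0 < rightLim (wronskian u wu v wv) x)
    (hw : rightLim u x = 0 → 0 < rightLim wu x) :
    (0 ≤ leftLim v x → 0 ≤ rightLim v x → wronskian u wu v wv x ≤ 0) ∧
      (leftLim v x ≤ 0 → rightLim v x ≤ 0 → 0 ≤ wronskian u wu v wv x) := by
  have hθ := hu.rightLim_wronskian_eq_theta_mul hv hc hx
  by_cases hne : leftLim u x = rightLim u x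
  · have hl0 : leftLim u x = 0 := le_antisymm hl (hne ▸ hr)
    have hr0 : rightLim u x = 0 := hne ▸ hl0
    have hW0 : wronskian u wu v wv x ≠ 0 := fun h0 => by simp [hθ, h0] at hW
    have hA := hu.jump_eq_zero_of_lims_eq_zero hc hx hW0 hl0 hr0
    rw [theta, hA, mul_zero, zero_mul, sub_zero, one_mul] at hθ
    have h2 := hu.rightLim_wronskian hv hx
    rw [hr0, zero_mul, zero_sub] at h2
    refine ⟨fun _ h3 => ?_, fun _ _ => by linarith⟩
    linarith [mul_nonneg h3 (hw hr0).le]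
  · have hA := hu.jump_pos_of_lims_ne hc hx hne
    have h1 := hu.cross_lims_eq_jump_mul_wronskian hv hc hx
    constructor <;> intro h2 h3
    · refine nonpos_of_mul_nonpos_right (h1 ▸ ?_) hA
      linarith [mul_nonneg h2 hr, mul_nonpos_of_nonneg_of_nonpos h3 hl]
    · refine nonneg_of_mul_nonneg_right (h1 ▸ ?_) hA
      linarith [mul_nonneg_of_nonpos_of_nonpos h3 hl, mul_nonpos_of_nonpos_of_nonneg h2 hr]

/-- The sign of the Wronskian at a point where `u` passes from nonnegative to nonpositive. -/
theorem wronskian_sign_of_nonneg_of_nonpos (hu : BalancedSolution I r α β u wu)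
    (hv : BalancedSolution I r α β v wv) (hc : RegularCoefficients I r α β) (hx : x ∈ I)
    (hl : 0 ≤ leftLim u x) (hr : rightLim u x ≤ 0) (hW : 0 < leftLim (wronskian u wu v wv) x)
    (hw : leftLim u x = 0 → leftLim wu x < 0) :
    (0 ≤ leftLim v x → 0 ≤ rightLim v x → 0 ≤ wronskian u wu v wv x) ∧
      (leftLim v x ≤ 0 → rightLim v x ≤ 0 → wronskian u wu v wv x ≤ 0) := by
  have hθ := hu.leftLim_wronskian_eq_theta_mul hv hc hx
  by_cases hne : leftLim u x = rightLim u x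
  · have hl0 : leftLim u x = 0 := le_antisymm (hne ▸ hr) hl
    have hr0 : rightLim u x = 0 := hne ▸ hl0
    have hW0 : wronskian u wu v wv x ≠ 0 := fun h0 => by simp [hθ, h0] at hW
    have hA := hu.jump_eq_zero_of_lims_eq_zero hc hx hW0 hl0 hr0
    rw [theta, hA, mul_zero, zero_mul, sub_zero, one_mul] at hθ
    have h2 := hu.leftLim_wronskian hv hx
    rw [hl0, zero_mul, zero_sub] at h2
    refine ⟨fun _ _ => by linarith, fun h3 _ => ?_⟩
    linarith [mul_nonneg_of_nonpos_of_nonpos h3 (hw hl0).le]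
  · have hA := hu.jump_pos_of_lims_ne hc hx hne
    have h1 := hu.cross_lims_eq_jump_mul_wronskian hv hc hx
    constructor <;> intro h2 h3
    · refine nonneg_of_mul_nonneg_right (h1 ▸ ?_) hA
      linarith [mul_nonneg h3 hl, mul_nonpos_of_nonneg_of_nonpos h2 hr]
    · refine nonpos_of_mul_nonpos_right (h1 ▸ ?_) hA
      linarith [mul_nonneg_of_nonpos_of_nonpos h2 hr, mul_nonpos_of_nonpos_of_nonneg h3 hl]

theorem changesSignIn_of_neg (hv : BalancedSolution I r α β v wv) {J : Set ℝ}
    (h : ChangesSignIn I (fun x => -v x) J) : ChangesSignIn I v J := by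
  obtain ⟨s, hs, δ, hδ, hsub, h1⟩ := h
  have hl : ∀ z ∈ Ioo (s - δ) s, leftLim (fun x => -v x) z = -leftLim v z := fun z hz =>
    hv.leftLim_neg (hsub ⟨hz.1, by linarith [hz.2]⟩)
  have hr : ∀ z ∈ Ioo s (s + δ), rightLim (fun x => -v x) z = -rightLim v z := fun z hz =>
    hv.rightLim_neg (hsub ⟨by linarith [hz.1], hz.2⟩)
  refine ⟨s, hs, δ, hδ, hsub, ?_⟩
  rcases h1 with ⟨h2, h3⟩ | ⟨h2, h3⟩
  · exact .inr ⟨fun z hz => by have := h2 z hz; rw [hl z hz] at this; linarith,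
      fun z hz => by have := h3 z hz; rw [hr z hz] at this; linarith⟩
  · exact .inl ⟨fun z hz => by have := h2 z hz; rw [hl z hz] at this; linarith,
      fun z hz => by have := h3 z hz; rw [hr z hz] at this; linarith⟩

/-- The Sturm separation theorem for solutions with nonvanishing Wronskian. -/
theorem sturm_separation (hu : BalancedSolution I r α β u wu)
    (hv : BalancedSolution I r α β v wv) (hc : RegularCoefficients I r α β)
    (hW0 : ∀ x ∈ I, wronskian u wu v wv x ≠ 0) {s t : ℝ} (hst : s < t) (hs : s ∈ I) (ht : t ∈ I)
    (hcons : ∀ x ∈ Ioo s t, 0 < leftLim u x * rightLim u x)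
    (hθ : ∀ x ∈ Ioo s t, 0 < theta α β r x / theta α β (1 - r) x) :
    (leftLim u s * rightLim u s < 0 → leftLim u t = 0 → 0 < theta α β r s →
      ChangesSignIn I v (Ico s t)) ∧
    (rightLim u s = 0 → leftLim u t * rightLim u t < 0 → 0 < theta α β (1 - r) t →
      ChangesSignIn I v (Ioc s t)) ∧
    (leftLim u s * rightLim u s < 0 → rightLim u t = 0 →
      0 < theta α β r s * theta α β (1 - r) t → ChangesSignIn I v (Icc s t)) ∧
    (leftLim u s = 0 → leftLim u t * rightLim u t < 0 →
      0 < theta α β r s * theta α β (1 - r) t → ChangesSignIn I v (Icc s t)) ∧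
    (leftLim u s * rightLim u s < 0 → leftLim u t * rightLim u t < 0 →
      0 < theta α β r s * theta α β (1 - r) t → ChangesSignIn I v (Icc s t)) := by
  have := hc.ordConnected
  have hsub : Icc s t ⊆ I := this.out hs ht
  have hsub' : Ioo s t ⊆ I := Ioo_subset_Icc_self.trans hsub
  wlog hup : ∀ x ∈ Ioo s t, 0 < leftLim u x ∧ 0 < rightLim u x generalizing u wu
  · have hun := ((hu.lims.mono hsub').constant_sign isPreconnected_Ioo hcons).resolve_left hup
    have h1 := this hu.neg (fun x hx => by
      have := hW0 x hx
      contrapose! this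
      simp only [wronskian] at this ⊢
      linarith) (fun x hx => by
        rw [hu.leftLim_neg (hsub' hx), hu.rightLim_neg (hsub' hx), neg_mul_neg]
        exact hcons x hx) (fun x hx => by
        rw [hu.leftLim_neg (hsub' hx), hu.rightLim_neg (hsub' hx)]
        exact ⟨neg_pos.2 (hun x hx).1, neg_pos.2 (hun x hx).2⟩)
    simpa only [hu.leftLim_neg hs, hu.rightLim_neg hs, hu.leftLim_neg ht, hu.rightLim_neg ht,
      neg_mul_neg, neg_eq_zero] using h1
  have hWl := hu.hasOneSidedLims_wronskian hv
  have hWprod : ∀ x ∈ Ioo s t, 0 < leftLim (wronskian u wu v wv) x *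
      rightLim (wronskian u wu v wv) x := by
    intro x hx
    have hxI := hsub' hx
    rw [hu.leftLim_wronskian_eq_theta_mul hv hc hxI, hu.rightLim_wronskian_eq_theta_mul hv hc hxI]
    have h1 : 0 < theta α β r x * theta α β (1 - r) x := by
      rcases div_pos_iff.1 (hθ x hx) with h | h
      · exact mul_pos h.1 h.2
      · exact mul_pos_of_neg_of_neg h.1 h.2
    have h2 := mul_pos h1 (mul_self_pos.2 (hW0 x hxI))
    linarith
  wlog hWp : ∀ x ∈ Ioo s t, 0 < leftLim (wronskian u wu v wv) x ∧
      0 < rightLim (wronskian u wu v wv) x generalizing v wv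
  · have hWn := ((hWl.mono hsub').constant_sign isPreconnected_Ioo hWprod).resolve_left hWp
    have hWneg : wronskian u wu (fun x => -v x) (fun x => -wv x) =
        fun x => -wronskian u wu v wv x := by
      ext x
      simp only [wronskian]
      ring
    have hl : ∀ x ∈ I, leftLim (wronskian u wu (fun x => -v x) (fun x => -wv x)) x =
        -leftLim (wronskian u wu v wv) x := fun x hx => by
      rw [hWneg]
      exact leftLim_eq_of_tendsto (hWl x hx).1.neg
    have hr : ∀ x ∈ I, rightLim (wronskian u wu (fun x => -v x) (fun x => -wv x)) x =
        -rightLim (wronskian u wu v wv) x := fun x hx => by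
      rw [hWneg]
      exact rightLim_eq_of_tendsto (hWl x hx).2.neg
    obtain ⟨h1, h2, h3, h4, h5⟩ := this hv.neg
      (fun x hx => by rw [hWneg]; exact neg_ne_zero.2 (hW0 x hx))
      (hu.hasOneSidedLims_wronskian hv.neg)
      (fun x hx => by rw [hl x (hsub' hx), hr x (hsub' hx), neg_mul_neg]; exact hWprod x hx)
      (fun x hx => by
        rw [hl x (hsub' hx), hr x (hsub' hx)]
        exact ⟨neg_pos.2 (hWn x hx).1, neg_pos.2 (hWn x hx).2⟩)
    exact ⟨fun a b c => hv.changesSignIn_of_neg (h1 a b c),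
      fun a b c => hv.changesSignIn_of_neg (h2 a b c),
      fun a b c => hv.changesSignIn_of_neg (h3 a b c),
      fun a b c => hv.changesSignIn_of_neg (h4 a b c),
      fun a b c => hv.changesSignIn_of_neg (h5 a b c)⟩
  have hus : 0 ≤ rightLim u s := ge_of_tendsto (hu.lims.rightLim_right hs)
    (mem_of_superset (Ioo_mem_nhdsGT hst) fun z hz => (hup z hz).2.le)
  have hut : 0 ≤ leftLim u t := ge_of_tendsto (hu.lims.leftLim_left ht)
    (mem_of_superset (Ioo_mem_nhdsLT hst) fun z hz => (hup z hz).1.le)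
  have hθs := hu.rightLim_wronskian_eq_theta_mul hv hc hs
  have hθt := hu.leftLim_wronskian_eq_theta_mul hv hc ht
  have hWs : 0 < rightLim (wronskian u wu v wv) s := by
    refine lt_of_le_of_ne (ge_of_tendsto (hWl.rightLim_right hs)
      (mem_of_superset (Ioo_mem_nhdsGT hst) fun z hz => (hWp z hz).2.le)) ?_
    rw [hθs]
    exact (mul_ne_zero (hc.theta_ne s hs) (hW0 s hs)).symm
  have hWt : 0 < leftLim (wronskian u wu v wv) t := by
    refine lt_of_le_of_ne (ge_of_tendsto (hWl.leftLim_left ht)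
      (mem_of_superset (Ioo_mem_nhdsLT hst) fun z hz => (hWp z hz).1.le)) ?_
    rw [hθt]
    exact (mul_ne_zero (hc.theta_one_sub_ne t ht) (hW0 t ht)).symm
  have hws : rightLim u s = 0 → 0 < rightLim wu s := by
    intro h0
    rcases lt_trichotomy (rightLim wu s) 0 with h1 | h1 | h1
    · obtain ⟨z, hz1, hz2⟩ := ((hu.eventually_neg_right hc hs h0 h1).and
        (Ioo_mem_nhdsGT hst)).exists
      exact absurd hz1.1 (hup z hz2).1.not_gt
    · rw [hu.rightLim_wronskian hv hs, h0, h1] at hWs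
      simp at hWs
    · exact h1
  have hwt : leftLim u t = 0 → leftLim wu t < 0 := by
    intro h0
    rcases lt_trichotomy (leftLim wu t) 0 with h1 | h1 | h1
    · exact h1
    · rw [hu.leftLim_wronskian hv ht, h0, h1] at hWt
      simp at hWt
    · obtain ⟨z, hz1, hz2⟩ := ((hu.eventually_neg_left hc ht h0 h1).and
        (Ioo_mem_nhdsLT hst)).exists
      exact absurd hz1.1 (hup z hz2).1.not_gt
  have hvne : ∀ x ∈ I, ¬(v x = 0 ∧ wv x = 0) := fun x hx h0 =>
    hW0 x hx (by simp [wronskian, h0.1, h0.2])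
  have hsign : ∀ J ⊆ Icc s t, IsPreconnected J → ¬ ChangesSignIn I v J → _ := fun J hJ hJc =>
    hv.weak_sign_of_not_changesSignIn hc hvne hJc (hJ.trans hsub)
  have hsl : leftLim u s * rightLim u s < 0 → leftLim u s ≤ 0 := fun h =>
    (neg_of_mul_neg_left h hus).le
  have htr : leftLim u t * rightLim u t < 0 → rightLim u t ≤ 0 := fun h =>
    (neg_of_mul_neg_right h hut).le
  have hclosed : leftLim u s ≤ 0 → rightLim u t ≤ 0 → 0 < theta α β r s * theta α β (1 - r) t →
      ChangesSignIn I v (Icc s t) := by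
    intro h1 h2 h3
    by_contra hn
    have hS := hu.wronskian_sign_of_nonpos_of_nonneg hv hc hs h1 hus hWs hws
    have hT := hu.wronskian_sign_of_nonneg_of_nonpos hv hc ht hut h2 hWt hwt
    have hprod : 0 < wronskian u wu v wv s * wronskian u wu v wv t := by
      have h4 := mul_pos hWs hWt
      rw [hθs, hθt, mul_mul_mul_comm] at h4
      exact pos_of_mul_pos_right h4 h3.le
    have hsJ : s ∈ Icc s t := left_mem_Icc.2 hst.le
    have htJ : t ∈ Icc s t := right_mem_Icc.2 hst.le
    rcases hsign _ subset_rfl isPreconnected_Icc hn with h4 | h4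
    · exact absurd hprod (mul_nonpos_of_nonpos_of_nonneg (hS.1 (h4 s hsJ).1 (h4 s hsJ).2)
        (hT.1 (h4 t htJ).1 (h4 t htJ).2)).not_gt
    · exact absurd hprod (mul_nonpos_of_nonneg_of_nonpos (hS.2 (h4 s hsJ).1 (h4 s hsJ).2)
        (hT.2 (h4 t htJ).1 (h4 t htJ).2)).not_gt
  refine ⟨fun h1 h2 h3 => ?_, fun h1 h2 h3 => ?_, fun h1 h2 h3 => hclosed (hsl h1) h2.le h3,
    fun h1 h2 h3 => hclosed h1.le (htr h2) h3, fun h1 h2 h3 => hclosed (hsl h1) (htr h2) h3⟩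
  · by_contra hn
    have hvt : 0 < leftLim v t := by
      have h4 := hu.leftLim_wronskian hv ht
      rw [h2, zero_mul, zero_sub] at h4
      by_contra h5
      linarith [mul_nonneg_of_nonpos_of_nonpos (not_lt.1 h5) (hwt h2).le]
    have hsJ : s ∈ Ico s t := left_mem_Ico.2 hst
    rcases hsign _ Ico_subset_Icc_self isPreconnected_Ico hn with h4 | h4
    · have hS := (hu.wronskian_sign_of_nonpos_of_nonneg hv hc hs (hsl h1) hus hWs hws).1
        (h4 s hsJ).1 (h4 s hsJ).2
      rw [hθs] at hWs
      exact absurd hWs (mul_nonpos_of_nonneg_of_nonpos h3.le hS).not_gt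
    · obtain ⟨z, hz1, hz2⟩ := (((hv.lims.leftLim_left ht).eventually_const_lt hvt).and
        (Ioo_mem_nhdsLT hst)).exists
      exact absurd hz1 (h4 z ⟨hz2.1.le, hz2.2⟩).1.not_gt
  · by_contra hn
    have hvs : rightLim v s < 0 := by
      have h4 := hu.rightLim_wronskian hv hs
      rw [h1, zero_mul, zero_sub] at h4
      by_contra h5
      linarith [mul_nonneg (not_lt.1 h5) (hws h1).le]
    have htJ : t ∈ Ioc s t := right_mem_Ioc.2 hst
    rcases hsign _ Ioc_subset_Icc_self isPreconnected_Ioc hn with h4 | h4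
    · obtain ⟨z, hz1, hz2⟩ := (((hv.lims.rightLim_right hs).eventually_lt_const hvs).and
        (Ioo_mem_nhdsGT hst)).exists
      exact absurd hz1 (h4 z ⟨hz2.1, hz2.2.le⟩).2.not_gt
    · have hT := (hu.wronskian_sign_of_nonneg_of_nonpos hv hc ht hut (htr h2) hWt hwt).2
        (h4 t htJ).1 (h4 t htJ).2
      rw [hθt] at hWt
      exact absurd hWt (mul_nonpos_of_nonneg_of_nonpos h3.le hT).not_gt

end BalancedSolution

theorem isOpen_EI (a b : EReal) : IsOpen (EI a b) :=
  (isOpen_Ioo (a := a) (b := b)).preimage continuous_coe_real_ereal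

theorem ordConnected_EI (a b : EReal) : OrdConnected (EI a b) :=
  ⟨fun _ hx _ hy _ hz => ⟨hx.1.trans_le (EReal.coe_le_coe_iff.2 hz.1),
    (EReal.coe_le_coe_iff.2 hz.2).trans_lt hy.2⟩⟩

/-- Sturm Separation Theorem II, Theorem 5.5. -/
theorem statement15 (a b : EReal) (hab : a < b) (r : ℝ) (hr : r ∈ Icc (0 : ℝ) 1)
    (α β : ℝ → ℝ) (hα : StrictMonoOn α (EI a b))
    (hβ : LocallyBoundedVariationOn β (EI a b))
    (hθ : ∀ x ∈ EI a b, theta α β (1 - r) x ≠ 0 ∧ theta α β r x ≠ 0)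
    (u wu v wv : ℝ → ℝ)
    (hu : IsHomSol (EI a b) r α β u wu) (hv : IsHomSol (EI a b) r α β v wv)
    (hind : ¬ LinDepOn (EI a b) u v)
    (s t : ℝ) (hst : s < t)
    (hs : s ∈ ZSet u (EI a b)) (ht : t ∈ ZSet u (EI a b))
    (hcons : ZSet u (Ioo s t) = ∅)
    (hθpos : ∀ x ∈ Ioo s t, 0 < theta α β r x / theta α β (1 - r) x) :
    (leftLim u s * rightLim u s < 0 → leftLim u t = 0 → 0 < theta α β r s →
      ChangesSignIn (EI a b) v (Ico s t)) ∧
    (rightLim u s = 0 → leftLim u t * rightLim u t < 0 → 0 < theta α β (1 - r) t →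
      ChangesSignIn (EI a b) v (Ioc s t)) ∧
    (leftLim u s * rightLim u s < 0 → rightLim u t = 0 →
      0 < theta α β r s * theta α β (1 - r) t →
      ChangesSignIn (EI a b) v (Icc s t)) ∧
    (leftLim u s = 0 → leftLim u t * rightLim u t < 0 →
      0 < theta α β r s * theta α β (1 - r) t →
      ChangesSignIn (EI a b) v (Icc s t)) ∧
    (leftLim u s * rightLim u s < 0 → leftLim u t * rightLim u t < 0 →
      0 < theta α β r s * theta α β (1 - r) t →
      ChangesSignIn (EI a b) v (Icc s t)) := by
  have hIopen := isOpen_EI a b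
  have hIconn := ordConnected_EI a b
  have hc : RegularCoefficients (EI a b) r α β :=
    { isOpen := hIopen
      ordConnected := hIconn
      mem_Icc := hr
      strictMonoOn := hα
      lims_left := .of_locallyBoundedVariationOn hIopen hα.monotoneOn.locallyBoundedVariationOn
      lims_right := .of_locallyBoundedVariationOn hIopen hβ
      theta_one_sub_ne := fun x hx => (hθ x hx).1
      theta_ne := fun x hx => (hθ x hx).2 }
  have hu' := hu.balancedSolution hIopen
  have hv' := hv.balancedSolution hIopen
  refine hu'.sturm_separation hv' hc (fun x hx => hu'.wronskian_ne_zero hv' hc hind hx) hst hs.1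
    ht.1 (fun x hx => ?_) hθpos
  by_contra hx'
  have hmem : x ∈ ZSet u (Ioo s t) := ⟨hx, not_lt.1 hx'⟩
  rw [hcons] at hmem
  exact hmem
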